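/- Let (Ω, 𝒜, μ, T) be an aperiodic dynamical system on a standard Borel probability space and let (aₙ) be an increasing sequence of positive reals with aₙ → ∞ and aₙ/n → 0. Then for every ε > 0 and every sequence (ν_k)_{k≥1} of Borel probability measures on ℝ each having zero mean, there exist a measurable set A ∈ 𝒜 with μ(A) < ε and a strictly increasing sequence of positive integers (n_k) such that the Lévy–Prokhorov distance between the law of (1/a_{n_k}) S_{n_k}(1_A − μ(A)) and ν_k tends to 0 as k → ∞. -/

import Mathlib

open MeasureTheory Filter Topology Set

lemma levyProkhorovDist_map_le_of_integral_le {Ω : Type*} [MeasurableSpace Ω]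
    (μ : Measure Ω) [IsProbabilityMeasure μ] {X Y : Ω → ℝ} (hX : Measurable X)
    (hY : Measurable Y) (hXY : Integrable (fun x => X x - Y x) μ) {δ : ℝ} (hδ : 0 < δ)
    (h : ∫ x, |X x - Y x| ∂μ ≤ δ ^ 2) :
    levyProkhorovDist (μ.map X) (μ.map Y) ≤ δ := by
  have := Measure.isProbabilityMeasure_map (μ := μ) hX.aemeasurable
  have := Measure.isProbabilityMeasure_map (μ := μ) hY.aemeasurable
  refine levyProkhorovDist_le_of_forall_le _ _ hδ.le fun ε B hε hB => ?_
  rw [Measure.map_apply hX hB, Measure.map_apply hY Metric.isOpen_thickening.measurableSet]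
  have hsub : X ⁻¹' B ⊆ Y ⁻¹' (Metric.thickening ε B) ∪ {x | ε ≤ |X x - Y x|} := by
    intro x hx
    by_cases hc : ε ≤ |X x - Y x|
    · exact Or.inr hc
    · refine Or.inl (Metric.mem_thickening_iff.2 ⟨X x, hx, ?_⟩)
      rw [dist_comm, Real.dist_eq]
      exact not_le.1 hc
  refine (measure_mono hsub).trans ((measure_union_le _ _).trans ?_)
  gcongr
  have hmk := mul_meas_ge_le_integral_of_nonneg (μ := μ) (f := fun x => |X x - Y x|)
    (ae_of_all _ fun x => abs_nonneg _) hXY.abs ε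
  have hε0 : 0 < ε := hδ.trans hε
  have hreal : μ.real {x | ε ≤ |X x - Y x|} ≤ ε := by
    have h1 : ε * μ.real {x | ε ≤ |X x - Y x|} ≤ δ ^ 2 := hmk.trans h
    nlinarith
  rw [← ENNReal.ofReal_toReal (measure_ne_top μ {x | ε ≤ |X x - Y x|})]
  exact ENNReal.ofReal_le_ofReal hreal

lemma exists_uniform_approx_of_finite_weights (F : Finset ℝ) (p : ℝ → ℝ)
    (hp : ∀ y ∈ F, 0 ≤ p y) (hsum : ∑ y ∈ F, p y = 1) {δ : ℝ} (hδ : 0 < δ) :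
    ∃ (q : ℕ) (z : Fin (q + 1) → ℝ), ∀ (ψ : ℝ → ℝ) (K : ℝ), (∀ y ∈ F, |ψ y| ≤ K) → |ψ 0| ≤ K →
      |∑ y ∈ F, p y * ψ y - (∑ j, ψ (z j)) / (q + 1 : ℕ)| ≤ δ * K := by
  obtain ⟨q, hq⟩ := exists_nat_gt (2 * F.card / δ)
  set c : ℝ → ℕ := fun y => ⌊(q + 1 : ℕ) * p y⌋₊ with hc
  have hqpos : (0 : ℝ) < (q + 1 : ℕ) := by positivity
  have hc1 : ∀ y ∈ F, (c y : ℝ) ≤ (q + 1 : ℕ) * p y := fun y hy =>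
    Nat.floor_le (mul_nonneg hqpos.le (hp y hy))
  have hc2 : ∀ y ∈ F, (q + 1 : ℕ) * p y - 1 ≤ (c y : ℝ) := fun y hy =>
    (Nat.sub_one_lt_floor _).le
  have hS1 : (∑ y ∈ F, (c y : ℝ)) ≤ (q + 1 : ℕ) := by
    calc (∑ y ∈ F, (c y : ℝ)) ≤ ∑ y ∈ F, (q + 1 : ℕ) * p y := Finset.sum_le_sum hc1
      _ = (q + 1 : ℕ) := by rw [← Finset.mul_sum, hsum, mul_one]
  have hS2 : (q + 1 : ℕ) - (F.card : ℝ) ≤ ∑ y ∈ F, (c y : ℝ) := by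
    calc (q + 1 : ℕ) - (F.card : ℝ) = ∑ y ∈ F, ((q + 1 : ℕ) * p y - 1) := by
          rw [Finset.sum_sub_distrib, ← Finset.mul_sum, hsum]; simp
      _ ≤ _ := Finset.sum_le_sum hc2
  have hS1' : ∑ y ∈ F, c y ≤ q + 1 := by exact_mod_cast hS1
  obtain ⟨r, hr⟩ := Nat.exists_eq_add_of_le hS1'
  have hrR : ((q + 1 : ℕ) : ℝ) = ∑ y ∈ F, (c y : ℝ) + r := by
    rw [hr]; push_cast; ring
  let ι := (Σ y : F, Fin (c y)) ⊕ Fin r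
  have hcard : Fintype.card ι = q + 1 := by
    simp only [ι, Fintype.card_sum, Fintype.card_sigma, Fintype.card_fin]
    rw [hr, Finset.sum_coe_sort F c]
  let e : Fin (q + 1) ≃ ι := (Fintype.equivFinOfCardEq hcard).symm
  let z : ι → ℝ := Sum.elim (fun s => (s.1 : ℝ)) (fun _ => 0)
  refine ⟨q, fun j => z (e j), fun ψ K hK hK0 => ?_⟩
  have hK' : 0 ≤ K := (abs_nonneg _).trans hK0
  have hsumψ : ∑ j, ψ (z (e j)) = ∑ y ∈ F, c y * ψ y + r * ψ 0 := by
    rw [Equiv.sum_comp e (fun i => ψ (z i)), Fintype.sum_sum_type, Fintype.sum_sigma]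
    simp only [z, Sum.elim_inl, Sum.elim_inr, Finset.sum_const, Finset.card_univ,
      Fintype.card_fin, nsmul_eq_mul]
    rw [Finset.sum_coe_sort F (fun y => (c y : ℝ) * ψ y)]
  rw [hsumψ]
  have hkey : ∑ y ∈ F, p y * ψ y - (∑ y ∈ F, c y * ψ y + r * ψ 0) / (q + 1 : ℕ)
      = (∑ y ∈ F, ((q + 1 : ℕ) * p y - c y) * ψ y - r * ψ 0) / (q + 1 : ℕ) := by
    simp only [sub_mul, Finset.sum_sub_distrib, mul_assoc, ← Finset.mul_sum]
    field_simp
    ring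
  rw [hkey, abs_div, abs_of_pos hqpos, div_le_iff₀ hqpos]
  have h1 : |∑ y ∈ F, ((q + 1 : ℕ) * p y - c y) * ψ y| ≤ F.card * K := by
    calc _ ≤ ∑ y ∈ F, |((q + 1 : ℕ) * p y - c y) * ψ y| := Finset.abs_sum_le_sum_abs _ _
      _ ≤ ∑ y ∈ F, 1 * K := by
          refine Finset.sum_le_sum fun y hy => ?_
          rw [abs_mul]
          refine mul_le_mul ?_ (hK y hy) (abs_nonneg _) zero_le_one
          rw [abs_of_nonneg (by linarith [hc1 y hy])]
          linarith [hc2 y hy]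
      _ = F.card * K := by simp
  have h2 : |(r : ℝ) * ψ 0| ≤ F.card * K := by
    rw [abs_mul, abs_of_nonneg (Nat.cast_nonneg r)]
    exact mul_le_mul (by linarith) hK0 (abs_nonneg _) (Nat.cast_nonneg _)
  have h3 : 2 * (F.card : ℝ) ≤ δ * (q + 1 : ℕ) := by
    rw [div_lt_iff₀ hδ] at hq
    push_cast
    nlinarith
  calc _ ≤ |∑ y ∈ F, ((q + 1 : ℕ) * p y - c y) * ψ y| + |(r : ℝ) * ψ 0| := abs_sub _ _
    _ ≤ 2 * F.card * K := by linarith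
    _ ≤ δ * (q + 1 : ℕ) * K := by gcongr
    _ = _ := by ring

/-- The uniform probability measure on the values of a finite family of reals. -/
noncomputable def empiricalMeasure {q : ℕ} (z : Fin (q + 1) → ℝ) : Measure ℝ :=
  (ProbabilityTheory.uniformOn (univ : Set (Fin (q + 1)))).map z

instance {q : ℕ} (z : Fin (q + 1) → ℝ) : IsProbabilityMeasure (empiricalMeasure z) :=
  Measure.isProbabilityMeasure_map (measurable_of_finite z).aemeasurable

lemma integral_uniformOn_fin {q : ℕ} (f : Fin (q + 1) → ℝ) :
    ∫ j, f j ∂(ProbabilityTheory.uniformOn (univ : Set (Fin (q + 1)))) =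
      (∑ j, f j) / (q + 1 : ℕ) := by
  rw [integral_fintype (Integrable.of_finite), Finset.sum_div]
  refine Finset.sum_congr rfl fun j _ => ?_
  have hq : ((q : ENNReal) + 1).toReal = q + 1 := by
    exact_mod_cast ENNReal.toReal_natCast (q + 1)
  simp only [measureReal_def, ProbabilityTheory.uniformOn_univ, Measure.count_singleton,
    Fintype.card_fin, Nat.cast_add, Nat.cast_one, ENNReal.toReal_div, ENNReal.toReal_one, hq,
    smul_eq_mul]
  field_simp

lemma empiricalMeasure_real_apply {q : ℕ} (z : Fin (q + 1) → ℝ) {B : Set ℝ}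
    (hB : MeasurableSet B) :
    (empiricalMeasure z).real B = (∑ j, B.indicator (fun _ => (1 : ℝ)) (z j)) / (q + 1 : ℕ) := by
  have hz := measurable_of_finite z
  rw [empiricalMeasure, map_measureReal_apply hz hB, ← integral_uniformOn_fin,
    ← integral_indicator_one (hz hB)]
  rfl

lemma exists_empiricalMeasure_close (ν : Measure ℝ) [IsProbabilityMeasure ν]
    (hint : Integrable (fun x : ℝ => x) ν) (hmean : ∫ x, x ∂ν = 0) {δ : ℝ} (hδ : 0 < δ) :
    ∃ (q : ℕ) (z : Fin (q + 1) → ℝ), ∑ j, z j = 0 ∧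
      levyProkhorovDist (empiricalMeasure z) ν ≤ δ := by
  set η : ℝ := min (δ / 4) 1 with hη
  have hη0 : 0 < η := by positivity
  obtain ⟨g, hg, hgm⟩ := (memLp_one_iff_integrable.2 hint).exists_simpleFunc_eLpNorm_sub_lt
    ENNReal.one_ne_top (ε := ENNReal.ofReal (η ^ 2)) (by simp; positivity)
  have hgi : Integrable g ν := memLp_one_iff_integrable.1 hgm
  have hdiff : Integrable (fun x => x - g x) ν := hint.sub hgi
  have hL1 : ∫ x, |x - g x| ∂ν ≤ η ^ 2 := by
    have h1 := ENNReal.toReal_mono ENNReal.ofReal_ne_top hg.le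
    rw [ENNReal.toReal_ofReal (by positivity)] at h1
    refine le_trans (le_of_eq ?_) h1
    rw [eLpNorm_one_eq_lintegral_enorm]
    exact integral_norm_eq_lintegral_enorm hdiff.aestronglyMeasurable
  have hgmean : |∫ x, g x ∂ν| ≤ η ^ 2 := by
    have : ∫ x, g x ∂ν = -∫ x, (x - g x) ∂ν := by
      rw [integral_sub hint hgi, hmean]; ring
    rw [this, abs_neg]
    exact (abs_integral_le_integral_abs).trans hL1
  have hd1 : levyProkhorovDist ν (ν.map g) ≤ η := by
    have := levyProkhorovDist_map_le_of_integral_le ν measurable_id g.measurable hdiff hη0 hL1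
    simpa using this
  obtain ⟨M, hM0, hM⟩ : ∃ M : ℝ, 1 ≤ M ∧ ∀ y ∈ g.range, |y| ≤ M := by
    refine ⟨1 + ∑ y ∈ g.range, |y|, ?_, fun y hy => ?_⟩
    · linarith [Finset.sum_nonneg (s := g.range) (f := fun y => |y|) fun y _ => abs_nonneg y]
    · linarith [Finset.single_le_sum (f := fun y : ℝ => |y|) (fun y _ => abs_nonneg y) hy]
  set p : ℝ → ℝ := fun y => ν.real (g ⁻¹' {y}) with hp
  have hpint : ∀ ψ : ℝ → ℝ, ∫ x, ψ (g x) ∂ν = ∑ y ∈ g.range, p y * ψ y := by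
    intro ψ
    have h1 : ∀ x, ψ (g x) = ∑ y ∈ g.range, (g ⁻¹' {y}).indicator (fun _ => ψ y) x := by
      intro x
      rw [Finset.sum_eq_single (g x)]
      · simp
      · intro y _ hy
        simp [hy.symm]
      · intro hx
        exact absurd (g.mem_range_self x) hx
    simp_rw [h1]
    rw [integral_finsetSum]
    · refine Finset.sum_congr rfl fun y _ => ?_
      rw [integral_indicator_const _ (g.measurableSet_preimage _), smul_eq_mul]
    · intro y _
      exact (integrable_const _).indicator (g.measurableSet_preimage _)
  have hpsum : ∑ y ∈ g.range, p y = 1 := by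
    have := hpint (fun _ => 1)
    simpa using this.symm
  obtain ⟨q, z, hz⟩ := exists_uniform_approx_of_finite_weights g.range p
    (fun y _ => measureReal_nonneg) hpsum (δ := η ^ 2 / M) (by positivity)
  have hq0 : (0 : ℝ) < (q + 1 : ℕ) := by positivity
  have hd2 : levyProkhorovDist (ν.map g) (empiricalMeasure z) ≤ η := by
    have := Measure.isProbabilityMeasure_map (μ := ν) g.measurable.aemeasurable
    refine levyProkhorovDist_le_of_forall_le _ _ hη0.le fun ε B hε hB => ?_
    have h1 := hz (B.indicator fun _ => 1) 1
      (fun y _ => by by_cases hy : y ∈ B <;> simp [hy])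
      (by by_cases hy : (0 : ℝ) ∈ B <;> simp [hy])
    rw [← empiricalMeasure_real_apply z hB, ← hpint] at h1
    have h2 : ∫ x, B.indicator (fun _ => (1 : ℝ)) (g x) ∂ν = (ν.map g).real B := by
      rw [map_measureReal_apply g.measurable hB, ← integral_indicator_one (g.measurable hB)]
      rfl
    rw [h2, mul_one] at h1
    have h3 : η ^ 2 / M ≤ η := by
      rw [div_le_iff₀ (by linarith)]
      nlinarith [min_le_right (δ / 4) 1]
    have h4 : (ν.map g).real B ≤ (empiricalMeasure z).real B + ε := by
      linarith [(abs_le.1 h1).2]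
    have h5 : (ν.map g) B ≤ (empiricalMeasure z) B + ENNReal.ofReal ε := by
      rw [← ENNReal.ofReal_toReal (measure_ne_top (ν.map g) B),
        ← ENNReal.ofReal_toReal (measure_ne_top (empiricalMeasure z) B),
        ← ENNReal.ofReal_add ENNReal.toReal_nonneg (hη0.trans hε).le]
      exact ENNReal.ofReal_le_ofReal h4
    refine h5.trans ?_
    gcongr
    exact Metric.self_subset_thickening (hη0.trans hε) _
  set s : ℝ := (∑ j, z j) / (q + 1 : ℕ) with hs
  have hs1 : |s| ≤ 2 * η ^ 2 := by
    have h1 := hz (fun y => y) M hM (by simp; linarith)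
    rw [← hpint (fun y => y), ← hs, div_mul_cancel₀ _ (by positivity)] at h1
    have := abs_le.1 h1
    have := abs_le.1 hgmean
    rw [abs_le]
    constructor <;> linarith
  have hd3 : levyProkhorovDist (empiricalMeasure z) (empiricalMeasure fun j => z j - s)
      ≤ 2 * η := by
    refine levyProkhorovDist_map_le_of_integral_le _ (measurable_of_finite _)
      (measurable_of_finite _) Integrable.of_finite (by positivity) ?_
    simp only [sub_sub_cancel, integral_const, probReal_univ, smul_eq_mul, one_mul]
    nlinarith
  refine ⟨q, fun j => z j - s, ?_, ?_⟩
  · rw [Finset.sum_sub_distrib]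
    simp only [Finset.sum_const, Finset.card_univ, Fintype.card_fin, nsmul_eq_mul, hs]
    field_simp
    ring
  · have := Measure.isProbabilityMeasure_map (μ := ν) g.measurable.aemeasurable
    have t1 := levyProkhorovDist_triangle ν (ν.map g) (empiricalMeasure z)
    have t2 := levyProkhorovDist_triangle ν (empiricalMeasure z)
      (empiricalMeasure fun j => z j - s)
    rw [levyProkhorovDist_comm]
    linarith [min_le_left (δ / 4) 1]

section Towers

variable {Ω : Type*} [MeasurableSpace Ω]

lemma iterate_symm_iterate (T : Ω ≃ᵐ Ω) {i j : ℕ} (hij : i ≤ j) (x : Ω) :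
    T.symm^[i] (T^[j] x) = T^[j - i] x := by
  obtain ⟨k, rfl⟩ := Nat.exists_eq_add_of_le hij
  rw [Function.iterate_add_apply, Nat.add_sub_cancel_left]
  exact Function.LeftInverse.iterate T.symm_apply_apply i _

lemma iterate_iterate_symm (T : Ω ≃ᵐ Ω) {i j : ℕ} (hij : i ≤ j) (x : Ω) :
    T^[i] (T.symm^[j] x) = T.symm^[j - i] x :=
  iterate_symm_iterate T.symm hij x

/-- The sets `F, T F, …, T^(H-1) F` are pairwise disjoint. -/
def IsTowerBase (T : Ω ≃ᵐ Ω) (H : ℕ) (F : Set Ω) : Prop :=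
  ∀ x ∈ F, ∀ i, 0 < i → i < H → T^[i] x ∉ F

lemma IsTowerBase.level_unique {T : Ω ≃ᵐ Ω} {H : ℕ} {F : Set Ω} (h : IsTowerBase T H F)
    {i j : ℕ} (hi : i < H) (hj : j < H) {x : Ω} (hxi : T.symm^[i] x ∈ F)
    (hxj : T.symm^[j] x ∈ F) : i = j := by
  rcases lt_trichotomy i j with hlt | rfl | hlt
  · refine absurd ?_ (h _ hxj (j - i) (by omega) (by omega))
    rwa [iterate_iterate_symm T (by omega), Nat.sub_sub_self hlt.le]
  · rfl
  · refine absurd ?_ (h _ hxi (i - j) (by omega) (by omega))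
    rwa [iterate_iterate_symm T (by omega), Nat.sub_sub_self hlt.le]

lemma measurable_iterate_equiv (T : Ω ≃ᵐ Ω) (i : ℕ) : Measurable (T^[i]) :=
  T.measurable.iterate i

lemma measureReal_level (μ : Measure Ω) {T : Ω ≃ᵐ Ω} (hT : MeasurePreserving T μ μ)
    {F : Set Ω} (hF : MeasurableSet F) (i : ℕ) : μ.real (T.symm^[i] ⁻¹' F) = μ.real F :=
  ((hT.symm T).iterate i).measureReal_preimage hF.nullMeasurableSet

lemma IsTowerBase.measureReal_levels (μ : Measure Ω) [IsProbabilityMeasure μ] {T : Ω ≃ᵐ Ω}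
    (hT : MeasurePreserving T μ μ) {H : ℕ} {F : Set Ω} (hF : MeasurableSet F)
    (h : IsTowerBase T H F) {s : Finset ℕ} (hs : ∀ i ∈ s, i < H) :
    μ.real (⋃ i ∈ s, T.symm^[i] ⁻¹' F) = s.card * μ.real F := by
  rw [measureReal_biUnion_finset]
  · simp [measureReal_level μ hT hF]
  · intro i hi j hj hij
    refine Set.disjoint_left.2 fun x hxi hxj => hij ?_
    exact h.level_unique (hs i hi) (hs j hj) hxi hxj
  · exact fun i _ => measurable_iterate_equiv T.symm i hF

lemma IsTowerBase.mul_measureReal_le_one (μ : Measure Ω) [IsProbabilityMeasure μ] {T : Ω ≃ᵐ Ω}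
    (hT : MeasurePreserving T μ μ) {H : ℕ} {F : Set Ω} (hF : MeasurableSet F)
    (h : IsTowerBase T H F) : H * μ.real F ≤ 1 := by
  have := h.measureReal_levels μ hT hF (s := Finset.range H) (by simp)
  rw [Finset.card_range] at this
  rw [← this]
  exact measureReal_le_one

/-- Aperiodic points are covered by countably many sets that are disjoint from their
first `n - 1` nontrivial translates. -/
lemma exists_countable_towerBase_cover [StandardBorelSpace Ω] (T : Ω ≃ᵐ Ω) (n : ℕ) :
    ∃ U : ℕ → Set Ω, (∀ k, MeasurableSet (U k)) ∧ (∀ k, IsTowerBase T n (U k)) ∧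
      ∀ x, (∀ i ≥ 1, T^[i] x ≠ x) → ∃ k, x ∈ U k := by
  obtain ⟨f, hf⟩ := exists_measurableEmbedding_real Ω
  obtain ⟨g, hg⟩ := exists_surjective_nat (ℚ × ℚ)
  refine ⟨fun k => {x | |f x - (g k).1| < (g k).2 / 2} ∩
    ⋂ i ∈ Finset.Ico 1 n, {x | ((g k).2 : ℝ) < |f (T^[i] x) - f x|}, fun k => ?_, fun k => ?_, ?_⟩
  · refine MeasurableSet.inter ?_ (Finset.measurableSet_biInter _ fun i _ => ?_)
    · exact measurableSet_lt (hf.measurable.sub_const _).abs measurable_const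
    · exact measurableSet_lt measurable_const
        ((hf.measurable.comp (measurable_iterate_equiv T i)).sub hf.measurable).abs
  · rintro x ⟨hx1, hx2⟩ i hi0 hin ⟨hy1, -⟩
    have h1 : ((g k).2 : ℝ) < |f (T^[i] x) - f x| := by
      simp only [mem_iInter] at hx2
      exact hx2 i (Finset.mem_Ico.2 ⟨hi0, hin⟩)
    simp only [mem_ofPred_eq] at hx1 hy1
    have := abs_sub_le (f (T^[i] x)) (g k).1 (f x)
    rw [abs_sub_comm ((g k).1 : ℝ)] at this
    linarith
  · intro x hx
    obtain ⟨δ, hδ0, hδ⟩ : ∃ δ : ℝ, 0 < δ ∧ ∀ i ∈ Finset.Ico 1 n, δ ≤ |f (T^[i] x) - f x| := by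
      by_cases hne : (Finset.Ico 1 n).Nonempty
      · obtain ⟨i, hi, hmin⟩ := Finset.exists_min_image _ (fun i => |f (T^[i] x) - f x|) hne
        refine ⟨_, abs_pos.2 (sub_ne_zero.2 fun h => ?_), hmin⟩
        exact hx i (Finset.mem_Ico.1 hi).1 (hf.injective h)
      · exact ⟨1, one_pos, fun i hi => absurd ⟨i, hi⟩ hne⟩
    obtain ⟨d, hd0, hd⟩ := exists_rat_btwn hδ0
    have hd0' : (0 : ℝ) < d / 2 := by linarith
    obtain ⟨r, hr1, hr2⟩ := exists_rat_btwn (show f x - d / 2 < f x by linarith)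
    obtain ⟨k, hk⟩ := hg (r, d)
    refine ⟨k, ?_, ?_⟩
    · simp only [mem_ofPred_eq, hk]
      rw [abs_lt]
      constructor <;> linarith
    · simp only [mem_iInter, mem_ofPred_eq, hk]
      exact fun i hi => hd.trans_le (hδ i hi)

lemma exists_marker [StandardBorelSpace Ω] (μ : Measure Ω) {T : Ω ≃ᵐ Ω}
    (hT : MeasurePreserving T μ μ) (haper : ∀ᵐ x ∂μ, ∀ i ≥ 1, T^[i] x ≠ x) (n : ℕ) :
    ∃ E : Set Ω, MeasurableSet E ∧ IsTowerBase T n E ∧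
      ∀ᵐ x ∂μ, ∃ k < 2 * n + 1, T.symm^[k] x ∈ E := by
  obtain ⟨U, hUm, hUt, hUc⟩ := exists_countable_towerBase_cover T n
  let E : ℕ → Set Ω := fun k => Nat.rec ∅ (fun k Ek => Ek ∪
    (U k \ ⋃ i ∈ Finset.range n, (T^[i] ⁻¹' Ek ∪ T.symm^[i] ⁻¹' Ek))) k
  have hE0 : E 0 = ∅ := rfl
  have hEs : ∀ k, E (k + 1) = E k ∪
    (U k \ ⋃ i ∈ Finset.range n, (T^[i] ⁻¹' E k ∪ T.symm^[i] ⁻¹' E k)) := fun k => rfl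
  have hEm : ∀ k, MeasurableSet (E k) := by
    intro k
    induction k with
    | zero => exact MeasurableSet.empty
    | succ k ih =>
      rw [hEs]
      refine ih.union ((hUm k).diff (Finset.measurableSet_biUnion _ fun i _ => ?_))
      exact (measurable_iterate_equiv T i ih).union (measurable_iterate_equiv T.symm i ih)
  have hEmono : Monotone E := monotone_nat_of_le_succ fun k => by
    rw [hEs]; exact subset_union_left
  have hEt : ∀ k, IsTowerBase T n (E k) := by
    intro k
    induction k with
    | zero => intro x hx; simp [hE0] at hx
    | succ k ih =>
      intro x hx i hi0 hin hy
      rw [hEs] at hx hy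
      rcases hx with hx | ⟨hxU, hxn⟩ <;> rcases hy with hy | ⟨hyU, hyn⟩
      · exact ih x hx i hi0 hin hy
      · refine hyn (mem_biUnion (Finset.mem_coe.2 (Finset.mem_range.2 hin)) (Or.inr ?_))
        rw [mem_preimage, iterate_symm_iterate T le_rfl, Nat.sub_self]
        exact hx
      · exact hxn (mem_biUnion (Finset.mem_coe.2 (Finset.mem_range.2 hin)) (Or.inl hy))
      · exact hUt k x hxU i hi0 hin hyU
  refine ⟨⋃ k, E k, MeasurableSet.iUnion hEm, ?_, ?_⟩
  · intro x hx i hi0 hin hy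
    obtain ⟨k, hk⟩ := mem_iUnion.1 hx
    obtain ⟨l, hl⟩ := mem_iUnion.1 hy
    exact hEt (max k l) x (hEmono (le_max_left _ _) hk) i hi0 hin (hEmono (le_max_right _ _) hl)
  · have hnear : ∀ x, (∀ i ≥ 1, T^[i] x ≠ x) →
        ∃ i ≤ n, T^[i] x ∈ ⋃ k, E k ∨ T.symm^[i] x ∈ ⋃ k, E k := by
      intro x hx
      obtain ⟨k, hk⟩ := hUc x hx
      by_cases hc : x ∈ ⋃ i ∈ Finset.range n, (T^[i] ⁻¹' E k ∪ T.symm^[i] ⁻¹' E k)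
      · simp only [mem_iUnion, Finset.mem_range] at hc
        obtain ⟨i, hi, hc | hc⟩ := hc
        · exact ⟨i, hi.le, Or.inl (mem_iUnion.2 ⟨k, hc⟩)⟩
        · exact ⟨i, hi.le, Or.inr (mem_iUnion.2 ⟨k, hc⟩)⟩
      · refine ⟨0, Nat.zero_le _, Or.inl (mem_iUnion.2 ⟨k + 1, ?_⟩)⟩
        rw [hEs]
        exact Or.inr ⟨hk, hc⟩
    filter_upwards [((hT.symm T).iterate n).quasiMeasurePreserving.ae haper] with x hx
    obtain ⟨i, hi, h | h⟩ := hnear _ hx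
    · rw [iterate_iterate_symm T hi] at h
      exact ⟨n - i, by omega, h⟩
    · rw [← Function.iterate_add_apply] at h
      exact ⟨i + n, by omega, h⟩

/-- Rokhlin's lemma. -/
lemma exists_rokhlin_tower [StandardBorelSpace Ω] (μ : Measure Ω) [IsProbabilityMeasure μ]
    {T : Ω ≃ᵐ Ω} (hT : MeasurePreserving T μ μ) (haper : ∀ᵐ x ∂μ, ∀ i ≥ 1, T^[i] x ≠ x)
    {H : ℕ} (hH : 0 < H) {e : ℝ} (he : 0 < e) :
    ∃ F : Set Ω, MeasurableSet F ∧ IsTowerBase T H F ∧ 1 - e ≤ H * μ.real F := by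
  obtain ⟨n, hn⟩ := exists_nat_gt ((H : ℝ) / e)
  obtain ⟨E, hEm, hEt, hEc⟩ := exists_marker μ hT haper n
  let D : ℕ → Set Ω := fun j => E \ ⋃ i ∈ Finset.Ico 1 ((j + 1) * H), T^[i] ⁻¹' E
  have hDm : ∀ j, MeasurableSet (D j) := fun j =>
    hEm.diff (Finset.measurableSet_biUnion _ fun i _ => measurable_iterate_equiv T i hEm)
  have hDn : ∀ j, ∀ y ∈ D j, ∀ i, 0 < i → i < (j + 1) * H → T^[i] y ∉ E := by
    intro j y hy i hi0 hi hyE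
    exact hy.2 (mem_biUnion (Finset.mem_coe.2 (Finset.mem_Ico.2 ⟨hi0, hi⟩)) hyE)
  let F : Set Ω := ⋃ j ∈ Finset.range (2 * n + 1), T.symm^[j * H] ⁻¹' D j
  have hFm : MeasurableSet F :=
    Finset.measurableSet_biUnion _ fun j _ => measurable_iterate_equiv T.symm _ (hDm j)
  refine ⟨F, hFm, ?_, ?_⟩
  · intro x hx i hi0 hiH hy
    simp only [F, mem_iUnion, mem_preimage] at hx hy
    obtain ⟨j, -, hj⟩ := hx
    obtain ⟨l, -, hl⟩ := hy
    rcases le_or_gt i (l * H) with hil | hil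
    · have hl' : T.symm^[l * H - i] x ∈ D l := by
        rw [show l * H = (l * H - i) + i by omega, Function.iterate_add_apply,
          iterate_symm_iterate T le_rfl, Nat.sub_self] at hl
        exact hl
      rcases lt_trichotomy (l * H - i) (j * H) with hlt | heq | hlt
      · refine hDn j _ hj (j * H - (l * H - i)) (by omega) (by rw [add_mul]; omega) ?_
        rw [iterate_iterate_symm T (by omega), Nat.sub_sub_self hlt.le]
        exact hl'.1
      · have h1 : i = (l - j) * H := by rw [Nat.sub_mul]; omega
        rcases Nat.eq_zero_or_pos (l - j) with h0 | h0
        · rw [h0] at h1; omega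
        · have := Nat.le_mul_of_pos_left H h0
          omega
      · refine hDn l _ hl' (l * H - i - j * H) (by omega) (by rw [add_mul]; omega) ?_
        rw [iterate_iterate_symm T (by omega), Nat.sub_sub_self hlt.le]
        exact hj.1
    · rw [iterate_symm_iterate T hil.le] at hl
      have h1 : T^[i - l * H + j * H] (T.symm^[j * H] x) ∈ E := by
        rw [Function.iterate_add_apply, iterate_iterate_symm T le_rfl, Nat.sub_self]
        exact hl.1
      exact hDn j _ hj _ (by omega) (by rw [add_mul]; omega) h1
  · have hcov : ∀ᵐ x ∂μ, x ∈ (⋃ i ∈ Finset.range H, T.symm^[i] ⁻¹' F) ∪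
        ⋃ i ∈ Finset.range H, T^[i] ⁻¹' E := by
      filter_upwards [hEc] with x hx
      classical
      have hex : ∃ k, T.symm^[k] x ∈ E := hx.imp fun k hk => hk.2
      obtain ⟨k, hkdef⟩ : ∃ k, k = Nat.find hex := ⟨_, rfl⟩
      have hkE : T.symm^[k] x ∈ E := hkdef ▸ Nat.find_spec hex
      have hkmin : ∀ l < k, T.symm^[l] x ∉ E := fun l hl => Nat.find_min hex (hkdef ▸ hl)
      have hkn : k < 2 * n + 1 := by
        obtain ⟨l, hl, hlE⟩ := hx
        by_contra hcon
        exact hkmin l (by omega) hlE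
      by_cases hD : T.symm^[k] x ∈ D (k / H)
      · left
        refine mem_biUnion (Finset.mem_coe.2 (Finset.mem_range.2 (Nat.mod_lt k hH))) ?_
        refine mem_biUnion (x := k / H) (Finset.mem_coe.2 (Finset.mem_range.2 ?_)) ?_
        · exact (Nat.div_le_self k H).trans_lt hkn
        · rw [mem_preimage, ← Function.iterate_add_apply, Nat.div_add_mod']
          exact hD
      · right
        have hD' : ∃ i ∈ Finset.Ico 1 ((k / H + 1) * H), T^[i] (T.symm^[k] x) ∈ E := by
          by_contra hcon
          refine hD ⟨hkE, fun hmem => hcon ?_⟩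
          simpa using hmem
        obtain ⟨i, hi, hiE⟩ := hD'
        rw [Finset.mem_Ico] at hi
        have hki : k < i := by
          by_contra hcon
          rw [iterate_iterate_symm T (by omega)] at hiE
          exact hkmin (k - i) (by omega) hiE
        have hmod := Nat.div_add_mod' k H
        rw [add_mul] at hi
        refine mem_biUnion (x := i - k) (Finset.mem_coe.2 (Finset.mem_range.2 (by omega))) ?_
        rw [show i = (i - k) + k by omega, Function.iterate_add_apply,
          iterate_iterate_symm T le_rfl, Nat.sub_self] at hiE
        exact hiE
    have h1 : (1 : ℝ) ≤ H * μ.real F + H * μ.real E := by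
      have hone : μ.real ((⋃ i ∈ Finset.range H, T.symm^[i] ⁻¹' F) ∪
        ⋃ i ∈ Finset.range H, T^[i] ⁻¹' E) = 1 := by
        rw [measureReal_def, (mem_ae_iff_prob_eq_one (MeasurableSet.union ?_ ?_)).1 hcov,
          ENNReal.toReal_one]
        · exact Finset.measurableSet_biUnion _ fun i _ => measurable_iterate_equiv T.symm i hFm
        · exact Finset.measurableSet_biUnion _ fun i _ => measurable_iterate_equiv T i hEm
      rw [← hone]
      refine (measureReal_union_le _ _).trans (add_le_add ?_ ?_)
      · refine (measureReal_biUnion_finset_le _ _).trans (le_of_eq ?_)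
        simp [measureReal_level μ hT hFm]
      · refine (measureReal_biUnion_finset_le _ _).trans (le_of_eq ?_)
        have := fun i => measureReal_level μ (T := T.symm) (hT.symm T) hEm i
        simp only [MeasurableEquiv.symm_symm] at this
        simp [this]
    have h2 := hEt.mul_measureReal_le_one μ hT hEm
    have h3 : (H : ℝ) * μ.real E ≤ e := by
      rw [div_lt_iff₀ he] at hn
      have h4 : (0 : ℝ) ≤ μ.real E := measureReal_nonneg
      nlinarith
    linarith

end Towers

lemma exists_subset_card_eq_symmDiff_card_le {I v : Finset ℕ} (hv : v ⊆ I) {t : ℕ}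
    (ht : t ≤ I.card) :
    ∃ u ⊆ I, u.card = t ∧ ((symmDiff v u).card : ℝ) ≤ |(v.card : ℝ) - t| := by
  rcases le_total t v.card with h | h
  · obtain ⟨u, huv, hu⟩ := Finset.exists_subset_card_eq h
    refine ⟨u, huv.trans hv, hu, ?_⟩
    rw [symmDiff_of_ge huv, Finset.card_sdiff_of_subset huv, hu, Nat.cast_sub h]
    exact le_abs_self _
  · obtain ⟨u, hvu, huI, hu⟩ := Finset.exists_subsuperset_card_eq hv h ht
    refine ⟨u, huI, hu, ?_⟩
    rw [symmDiff_of_le hvu, Finset.card_sdiff_of_subset hvu, hu, Nat.cast_sub h, abs_sub_comm]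
    exact le_abs_self _

/-- A pattern `s` of integers can be modified, block by block, so as to have prescribed
density `w` up to a bounded error. -/
lemma exists_pattern_of_density (m : ℕ) (w : ℕ → ℝ) (hw : ∀ i, 0 ≤ w i)
    (hw' : ∀ i, w i ≤ 1) (K : ℕ) (s : Finset ℕ) :
    ∃ u ⊆ Finset.range (K * m),
      (∀ t ≤ K * m, |((u.filter (· < t)).card : ℝ) - ∑ i ∈ Finset.range t, w i| ≤ m + 1) ∧
      ((symmDiff (s ∩ Finset.range (K * m)) u).card : ℝ) ≤ ∑ k ∈ Finset.range K,
        (|((s ∩ Finset.Ico (k * m) ((k + 1) * m)).card : ℝ) -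
          ∑ i ∈ Finset.Ico (k * m) ((k + 1) * m), w i| + 1) := by
  set W : ℕ → ℝ := fun t => ∑ i ∈ Finset.range t, w i with hW
  have hW0 : ∀ t, 0 ≤ W t := fun t => Finset.sum_nonneg fun i _ => hw i
  have hWI : ∀ {a b : ℕ}, a ≤ b → ∑ i ∈ Finset.Ico a b, w i = W b - W a := fun h =>
    Finset.sum_Ico_eq_sub _ h
  have hWm : ∀ {a b : ℕ}, a ≤ b → W a ≤ W b := fun {a b} h => by
    have h1 := hWI h
    have h2 : 0 ≤ ∑ i ∈ Finset.Ico a b, w i := Finset.sum_nonneg fun i _ => hw i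
    linarith
  have hWl : ∀ {a b : ℕ}, a ≤ b → W b ≤ W a + (b - a) := fun {a b} h => by
    have h1 := hWI h
    have h2 : ∑ i ∈ Finset.Ico a b, w i ≤ ∑ i ∈ Finset.Ico a b, 1 :=
      Finset.sum_le_sum fun i _ => hw' i
    simp only [Finset.sum_const, Nat.card_Ico, nsmul_eq_mul, mul_one, Nat.cast_sub h] at h2
    linarith
  suffices h : ∃ u ⊆ Finset.range (K * m), u.card = ⌊W (K * m)⌋₊ ∧
      (∀ t ≤ K * m, |((u.filter (· < t)).card : ℝ) - W t| ≤ m + 1) ∧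
      ((symmDiff (s ∩ Finset.range (K * m)) u).card : ℝ) ≤ ∑ k ∈ Finset.range K,
        (|((s ∩ Finset.Ico (k * m) ((k + 1) * m)).card : ℝ) -
          ∑ i ∈ Finset.Ico (k * m) ((k + 1) * m), w i| + 1) by
    obtain ⟨u, h1, -, h2⟩ := h
    exact ⟨u, h1, h2⟩
  induction K with
  | zero =>
    refine ⟨∅, by simp, by simp [hW], ?_, by simp⟩
    intro t ht
    obtain rfl : t = 0 := by omega
    simp only [Finset.filter_empty, Finset.card_empty, hW, Finset.range_zero, Finset.sum_empty]
    simp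
    positivity
  | succ K ih =>
    obtain ⟨u, hu, hucard, hub, hud⟩ := ih
    have hlt : K * m ≤ (K + 1) * m := Nat.mul_le_mul_right _ (Nat.le_succ _)
    have hcast : (((K + 1) * m : ℕ) : ℝ) - ((K * m : ℕ) : ℝ) = m := by push_cast; ring
    set I := Finset.Ico (K * m) ((K + 1) * m) with hI
    have hIcard : I.card = m := by rw [hI, Nat.card_Ico, Nat.succ_mul]; omega
    set a := ⌊W (K * m)⌋₊ with ha
    set b := ⌊W ((K + 1) * m)⌋₊ with hb
    have hab : a ≤ b := Nat.floor_mono (hWm hlt)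
    have hba : b ≤ a + m := by
      rw [ha, ← Nat.floor_add_natCast (hW0 _)]
      refine Nat.floor_mono ?_
      linarith [hWl hlt]
    obtain ⟨v, hvI, hvcard, hvd⟩ := exists_subset_card_eq_symmDiff_card_le
      (Finset.inter_subset_right (s₁ := s) (s₂ := I)) (t := b - a) (by omega)
    have ha1 := Nat.floor_le (hW0 (K * m))
    have ha2 := Nat.lt_floor_add_one (W (K * m))
    have hb1 := Nat.floor_le (hW0 ((K + 1) * m))
    have hb2 := Nat.lt_floor_add_one (W ((K + 1) * m))
    have hdisj : Disjoint u v := by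
      refine Finset.disjoint_left.2 fun i hi hj => ?_
      have h1 := Finset.mem_range.1 (hu hi)
      have h2 := (Finset.mem_Ico.1 (hvI hj)).1
      omega
    refine ⟨u ∪ v, ?_, ?_, ?_, ?_⟩
    · refine Finset.union_subset (hu.trans (Finset.range_mono hlt)) (hvI.trans ?_)
      exact fun i hi => Finset.mem_range.2 (Finset.mem_Ico.1 hi).2
    · rw [Finset.card_union_of_disjoint hdisj, hucard, hvcard]
      omega
    · intro t ht
      rcases le_total t (K * m) with htK | htK
      · have : (u ∪ v).filter (· < t) = u.filter (· < t) := by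
          ext i
          simp only [Finset.mem_filter, Finset.mem_union]
          refine ⟨fun ⟨h1, h2⟩ => ⟨h1.resolve_right fun h3 => ?_, h2⟩, fun h => ⟨Or.inl h.1, h.2⟩⟩
          have := (Finset.mem_Ico.1 (hvI h3)).1
          omega
        rw [this]
        exact hub t htK
      · have h1 : u ⊆ (u ∪ v).filter (· < t) := fun i hi => by
          have := Finset.mem_range.1 (hu hi)
          simp only [Finset.mem_filter, Finset.mem_union]
          exact ⟨Or.inl hi, by omega⟩
        have h2 : (u ∪ v).filter (· < t) ⊆ u ∪ Finset.Ico (K * m) t := fun i hi => by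
          simp only [Finset.mem_filter, Finset.mem_union] at hi
          rcases hi with ⟨hi | hi, hit⟩
          · exact Finset.mem_union_left _ hi
          · exact Finset.mem_union_right _
              (Finset.mem_Ico.2 ⟨(Finset.mem_Ico.1 (hvI hi)).1, hit⟩)
        have h3 := Finset.card_le_card h1
        have h4 := (Finset.card_le_card h2).trans (Finset.card_union_le _ _)
        rw [Nat.card_Ico, hucard] at h4
        rw [hucard] at h3
        have h3' : (a : ℝ) ≤ ((u ∪ v).filter (· < t)).card := by exact_mod_cast h3
        have h4' : (((u ∪ v).filter (· < t)).card : ℝ) ≤ a + (t - (K * m : ℕ)) := by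
          rw [← Nat.cast_sub htK]
          exact_mod_cast h4
        have h5 := hWl htK
        have h6 := hWm htK
        have h7 : (t : ℝ) ≤ ((K + 1) * m : ℕ) := by exact_mod_cast ht
        rw [abs_le]
        constructor <;> linarith
    · have hsplit : s ∩ Finset.range ((K + 1) * m) = (s ∩ Finset.range (K * m)) ∪ (s ∩ I) := by
        ext i
        simp only [Finset.mem_inter, Finset.mem_union, Finset.mem_range, hI, Finset.mem_Ico]
        constructor
        · rintro ⟨h1, h2⟩
          rcases lt_or_ge i (K * m) with h3 | h3
          · exact Or.inl ⟨h1, h3⟩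
          · exact Or.inr ⟨h1, h3, h2⟩
        · rintro (⟨h1, h2⟩ | ⟨h1, -, h2⟩)
          · exact ⟨h1, by omega⟩
          · exact ⟨h1, h2⟩
      have hsub : symmDiff ((s ∩ Finset.range (K * m)) ∪ (s ∩ I)) (u ∪ v) ⊆
          symmDiff (s ∩ Finset.range (K * m)) u ∪ symmDiff (s ∩ I) v := by
        intro i hi
        simp only [Finset.mem_symmDiff, Finset.mem_union] at hi ⊢
        tauto
      have h1 := (Finset.card_le_card hsub).trans (Finset.card_union_le _ _)
      rw [hsplit, Finset.sum_range_succ]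
      have h2 : ((symmDiff ((s ∩ Finset.range (K * m)) ∪ (s ∩ I)) (u ∪ v)).card : ℝ) ≤
        (symmDiff (s ∩ Finset.range (K * m)) u).card + (symmDiff (s ∩ I) v).card := by
        exact_mod_cast h1
      refine h2.trans (add_le_add hud (hvd.trans ?_))
      rw [hWI hlt, Nat.cast_sub hab]
      refine (abs_sub_le _ (W ((K + 1) * m) - W (K * m)) _).trans ?_
      gcongr
      rw [abs_le]
      constructor <;> linarith

section Rearrangement

/-- The indicator function of `B`, centered at `β`. -/
noncomputable def centeredIndicator {Ω : Type*} (β : ℝ) (B : Set Ω) (x : Ω) : ℝ :=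
  B.indicator (fun _ => (1 : ℝ)) x - β

lemma abs_centeredIndicator_le {Ω : Type*} {β : ℝ} (hβ0 : 0 ≤ β) (hβ1 : β ≤ 1) (B : Set Ω) (x : Ω) :
    |centeredIndicator β B x| ≤ 1 := by
  rw [centeredIndicator, abs_le]
  by_cases hx : x ∈ B <;> simp [hx] <;> constructor <;> linarith

variable {Ω : Type*} [MeasurableSpace Ω]

lemma measurable_centeredIndicator (β : ℝ) {B : Set Ω} (hB : MeasurableSet B) :
    Measurable (centeredIndicator β B) :=
  (measurable_const.indicator hB).sub_const β

/-- The function `1_A - β` is within `η` in `L¹` of the coboundary of a bounded function. -/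
def NearCoboundary (μ : Measure Ω) (T : Ω ≃ᵐ Ω) (β : ℝ) (A : Set Ω) (η : ℝ) : Prop :=
  ∃ u : Ω → ℝ, Measurable u ∧ (∃ K, ∀ x, |u x| ≤ K) ∧
    ∫ x, |centeredIndicator β A x - (u x - u (T x))| ∂μ ≤ η

lemma IsTowerBase.sum_setIntegral_le (μ : Measure Ω) [IsProbabilityMeasure μ] {T : Ω ≃ᵐ Ω}
    (hT : MeasurePreserving T μ μ) {H : ℕ} {F : Set Ω} (hF : MeasurableSet F)
    (h : IsTowerBase T H F) {φ : Ω → ℝ} (hφ : Integrable φ μ) (hφ0 : ∀ x, 0 ≤ φ x) :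
    ∑ i ∈ Finset.range H, ∫ x in F, φ (T^[i] x) ∂μ ≤ ∫ x, φ x ∂μ := by
  have h1 : ∀ i, ∫ x in F, φ (T^[i] x) ∂μ = ∫ x in T.symm^[i] ⁻¹' F, φ x ∂μ := by
    intro i
    have hemb : MeasurableEmbedding (T^[i]) := by
      induction i with
      | zero => exact MeasurableEmbedding.id
      | succ i ih => exact ih.comp T.measurableEmbedding
    rw [← (hT.iterate i).setIntegral_preimage_emb hemb φ (T.symm^[i] ⁻¹' F)]
    congr 2
    ext x
    rw [mem_preimage, mem_preimage, iterate_symm_iterate T le_rfl, Nat.sub_self]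
    rfl
  simp_rw [h1]
  rw [← integral_biUnion_finset]
  · exact setIntegral_le_integral hφ (ae_of_all _ hφ0)
  · exact fun i _ => measurable_iterate_equiv T.symm i hF
  · intro i hi j hj hij
    refine Set.disjoint_left.2 fun x hxi hxj => hij ?_
    exact h.level_unique (by simpa using hi) (by simpa using hj) hxi hxj
  · exact fun i _ => hφ.integrableOn

lemma IsTowerBase.measureReal_compl_levels_le (μ : Measure Ω) [IsProbabilityMeasure μ]
    {T : Ω ≃ᵐ Ω} (hT : MeasurePreserving T μ μ) {H : ℕ} {F : Set Ω} (hF : MeasurableSet F)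
    (h : IsTowerBase T H F) {e : ℝ} (he : 1 - e ≤ H * μ.real F) :
    μ.real (⋃ i ∈ Finset.range H, T.symm^[i] ⁻¹' F)ᶜ ≤ e := by
  rw [probReal_compl_eq_one_sub
    (Finset.measurableSet_biUnion _ fun i _ => measurable_iterate_equiv T.symm i hF),
    h.measureReal_levels μ hT hF (by simp), Finset.card_range]
  linarith

lemma integrable_of_measurable_of_abs_le (μ : Measure Ω) [IsProbabilityMeasure μ] {f : Ω → ℝ}
    (hf : Measurable f) {K : ℝ} (hK : ∀ x, |f x| ≤ K) : Integrable f μ :=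
  Integrable.of_bound hf.aestronglyMeasurable K (ae_of_all _ hK)

/-- If all column sums of `1_B - β` in a large tower are small, then `1_B - β` is close to a
coboundary. -/
lemma nearCoboundary_of_tower (μ : Measure Ω) [IsProbabilityMeasure μ]
    {T : Ω ≃ᵐ Ω} (hT : MeasurePreserving T μ μ) {H : ℕ} (hH : 0 < H) {F : Set Ω}
    (hF : MeasurableSet F) (h : IsTowerBase T H F) {e : ℝ} (he : 1 - e ≤ H * μ.real F)
    {β : ℝ} (hβ0 : 0 ≤ β) (hβ1 : β ≤ 1) {B : Set Ω} (hB : MeasurableSet B) {C : ℝ} (hC0 : 0 ≤ C)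
    (hC : ∀ b ∈ F, |∑ i ∈ Finset.range H, centeredIndicator β B (T^[i] b)| ≤ C) :
    NearCoboundary μ T β B (e + C / H) := by
  set f := centeredIndicator β B with hf
  have hfm : Measurable f := measurable_centeredIndicator β hB
  have hf1 : ∀ x, |f x| ≤ 1 := abs_centeredIndicator_le hβ0 hβ1 B
  let φ : ℕ → Ω → ℝ := fun k b => -∑ i ∈ Finset.range k, f (T^[i] b)
  have hφm : ∀ k, Measurable (φ k) := fun k =>
    (Finset.measurable_sum _ fun i _ => hfm.comp (measurable_iterate_equiv T i)).neg
  let u : Ω → ℝ := fun x => ∑ k ∈ Finset.range H, F.indicator (φ k) (T.symm^[k] x)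
  have hum : Measurable u := Finset.measurable_sum _ fun k _ =>
    ((hφm k).indicator hF).comp (measurable_iterate_equiv T.symm k)
  have hub : ∀ x, |u x| ≤ ∑ k ∈ Finset.range H, (k : ℝ) := by
    intro x
    refine (Finset.abs_sum_le_sum_abs _ _).trans (Finset.sum_le_sum fun k _ => ?_)
    by_cases hx : T.symm^[k] x ∈ F
    · rw [indicator_of_mem hx, abs_neg]
      refine (Finset.abs_sum_le_sum_abs _ _).trans ?_
      refine (Finset.sum_le_sum fun i _ => hf1 _).trans ?_
      simp
    · rw [indicator_of_notMem hx, abs_zero]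
      positivity
  have hu_level : ∀ x k, k < H → T.symm^[k] x ∈ F → u x = φ k (T.symm^[k] x) := by
    intro x k hk hx
    simp only [u]
    rw [Finset.sum_eq_single k]
    · rw [indicator_of_mem hx]
    · intro l hl hlk
      exact indicator_of_notMem
        (fun hxl => hlk (h.level_unique (Finset.mem_range.1 hl) hk hxl hx)) _
    · exact fun hk' => absurd (Finset.mem_range.2 hk) hk'
  have hu_zero : ∀ x, (∀ k, 0 < k → k < H → T.symm^[k] x ∉ F) → u x = 0 := by
    intro x hx
    refine Finset.sum_eq_zero fun k hk => ?_
    rcases Nat.eq_zero_or_pos k with rfl | hk0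
    · by_cases hx0 : T.symm^[0] x ∈ F
      · rw [indicator_of_mem hx0]
        simp [φ]
      · exact indicator_of_notMem hx0 _
    · exact indicator_of_notMem (hx k hk0 (Finset.mem_range.1 hk)) _
  have hpred : ∀ x k, T.symm^[k + 1] (T x) = T.symm^[k] x := by
    intro x k
    rw [Function.iterate_succ_apply, T.symm_apply_apply]
  set L : Set Ω := ⋃ i ∈ Finset.range H, T.symm^[i] ⁻¹' F with hL
  have hLm : MeasurableSet L :=
    Finset.measurableSet_biUnion _ fun i _ => measurable_iterate_equiv T.symm i hF
  have hmemL : ∀ x k, k < H → T.symm^[k] x ∈ F → x ∈ L := fun x k hk hx =>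
    mem_biUnion (Finset.mem_coe.2 (Finset.mem_range.2 hk)) hx
  set P : Set Ω := T.symm^[H - 1] ⁻¹' F with hP
  have hPm : MeasurableSet P := measurable_iterate_equiv T.symm _ hF
  have hbound : ∀ x, |f x - (u x - u (T x))| ≤
      Lᶜ.indicator (fun _ => (1 : ℝ)) x + P.indicator (fun _ => C) x := by
    intro x
    by_cases hx : x ∈ L
    · obtain ⟨k, hk, hxk⟩ : ∃ k < H, T.symm^[k] x ∈ F := by
        simp only [hL, mem_iUnion, Finset.mem_range, mem_preimage] at hx
        obtain ⟨k, hk, hxk⟩ := hx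
        exact ⟨k, hk, hxk⟩
      have hfx : f x = f (T^[k] (T.symm^[k] x)) := by
        rw [iterate_iterate_symm T le_rfl, Nat.sub_self]; rfl
      rw [indicator_of_notMem (by simpa using hx), zero_add]
      rcases Nat.lt_or_ge (k + 1) H with hk1 | hk1
      · have h1 : u (T x) = φ (k + 1) (T.symm^[k] x) := by
          rw [hu_level (T x) (k + 1) hk1 (by rwa [hpred]), hpred]
        rw [h1, hu_level x k hk hxk]
        simp only [φ, Finset.sum_range_succ]
        rw [← hfx]
        rw [show f x - (-∑ i ∈ Finset.range k, f (T^[i] (T.symm^[k] x)) -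
          -(∑ i ∈ Finset.range k, f (T^[i] (T.symm^[k] x)) + f x)) = 0 by ring, abs_zero]
        exact indicator_nonneg (fun _ _ => hC0) _
      · obtain rfl : k = H - 1 := by omega
        have h1 : u (T x) = 0 := by
          refine hu_zero _ fun l hl0 hlH hl => ?_
          obtain ⟨l, rfl⟩ := Nat.exists_eq_succ_of_ne_zero hl0.ne'
          rw [Nat.succ_eq_add_one, hpred] at hl
          have := h.level_unique (by omega) hk hl hxk
          omega
        rw [h1, hu_level x _ hk hxk, indicator_of_mem (show x ∈ P from hxk), sub_zero]
        have h2 := hC _ hxk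
        rw [show Finset.range H = Finset.range (H - 1 + 1) by congr 1; omega,
          Finset.sum_range_succ, ← hfx] at h2
        simp only [φ]
        rwa [sub_neg_eq_add, add_comm]
    · have h0 : u x = 0 := hu_zero _ fun k _ hk hxk => hx (hmemL x k hk hxk)
      have h1 : u (T x) = 0 := by
        refine hu_zero _ fun l hl0 hlH hl => ?_
        obtain ⟨l, rfl⟩ := Nat.exists_eq_succ_of_ne_zero hl0.ne'
        rw [Nat.succ_eq_add_one, hpred] at hl
        exact hx (hmemL x l (by omega) hl)
      rw [h0, h1, indicator_of_mem (by simpa using hx)]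
      have := hf1 x
      have h2 : 0 ≤ P.indicator (fun _ => C) x := indicator_nonneg (fun _ _ => hC0) _
      simp only [sub_zero]
      linarith
  refine ⟨u, hum, ⟨_, hub⟩, ?_⟩
  have hi1 : Integrable (Lᶜ.indicator (fun _ => (1 : ℝ))) μ :=
    (integrable_const _).indicator hLm.compl
  have hi2 : Integrable (P.indicator (fun _ => C)) μ := (integrable_const _).indicator hPm
  calc ∫ x, |f x - (u x - u (T x))| ∂μ
      ≤ ∫ x, (Lᶜ.indicator (fun _ => (1 : ℝ)) x + P.indicator (fun _ => C) x) ∂μ :=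
        integral_mono_of_nonneg (ae_of_all _ fun _ => abs_nonneg _) (hi1.add hi2)
          (ae_of_all _ hbound)
    _ = μ.real Lᶜ + μ.real P * C := by
        rw [integral_add hi1 hi2, integral_indicator_const _ hLm.compl,
          integral_indicator_const _ hPm, smul_eq_mul, smul_eq_mul, mul_one]
    _ ≤ e + C / H := by
        have h1 := h.measureReal_compl_levels_le μ hT hF he
        have h2 : μ.real P = μ.real F := measureReal_level μ hT hF _
        have h3 := h.mul_measureReal_le_one μ hT hF
        have hH' : (0 : ℝ) < H := by exact_mod_cast hH
        have h4 : μ.real F * C ≤ C / H := by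
          rw [le_div_iff₀ hH']
          nlinarith
        rw [h2]
        linarith

lemma sum_range_sum_Ico_mul (φ : ℕ → ℝ) (K m : ℕ) :
    ∑ k ∈ Finset.range K, ∑ i ∈ Finset.Ico (k * m) ((k + 1) * m), φ i =
      ∑ i ∈ Finset.range (K * m), φ i := by
  induction K with
  | zero => simp
  | succ K ih =>
    rw [Finset.sum_range_succ, ih,
      Finset.sum_range_add_sum_Ico _ (Nat.mul_le_mul_right _ (Nat.le_succ _))]

/-- A set can be modified inside a tower so that in every column it has a prescribed density. -/
lemma exists_rearrangement (μ : Measure Ω) [IsProbabilityMeasure μ]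
    {T : Ω ≃ᵐ Ω} (hT : MeasurePreserving T μ μ) {K m : ℕ} (hm : 0 < m) {F : Set Ω}
    (hF : MeasurableSet F) (h : IsTowerBase T (K * m) F) {e : ℝ}
    (he : 1 - e ≤ (K * m : ℕ) * μ.real F)
    {β : ℝ} (hβ0 : 0 ≤ β) (hβ1 : β ≤ 1) {A : Set Ω} (hA : MeasurableSet A) {η : ℝ}
    {u : Ω → ℝ} (hu : Measurable u) {M : ℝ} (huM : ∀ x, |u x| ≤ M)
    (huη : ∫ x, |centeredIndicator β A x - (u x - u (T x))| ∂μ ≤ η)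
    (w : ℕ → ℝ) (hw : ∀ i, 0 ≤ w i) (hw' : ∀ i, w i ≤ 1) {ρ : ℝ} (hwρ : ∀ i, |w i - β| ≤ ρ) :
    ∃ B : Set Ω, MeasurableSet B ∧
      (∀ b ∈ F, ∀ t ≤ K * m,
        |∑ i ∈ Finset.range t, (B.indicator (fun _ => (1 : ℝ)) (T^[i] b) - w i)| ≤ m + 1) ∧
      μ.real (symmDiff A B) ≤ e + η + (2 * M + 1) / m + ρ := by
  classical
  set H := K * m with hH
  choose Φ hΦ1 hΦ2 hΦ3 using exists_pattern_of_density m w hw hw' K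
  let pat : Ω → Finset ℕ := fun b => (Finset.range H).filter fun i => T^[i] b ∈ A
  have hpat : ∀ (p : Finset ℕ → Prop), MeasurableSet {b | p (pat b)} := by
    intro p
    let _ : MeasurableSpace (Finset ℕ) := ⊤
    have hpm : Measurable pat := by
      refine measurable_to_countable' fun s => ?_
      have : pat ⁻¹' {s} = {b | ∀ i, i ∈ pat b ↔ i ∈ s} := by
        ext b; simp [Finset.ext_iff]
      rw [this, ofPred_forall]
      refine MeasurableSet.iInter fun i => ?_
      have h1 : MeasurableSet {b | i ∈ pat b} := by
        by_cases hi : i < H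
        · have : {b | i ∈ pat b} = T^[i] ⁻¹' A := by ext b; simp [pat, hi]
          rw [this]
          exact measurable_iterate_equiv T i hA
        · have : {b | i ∈ pat b} = ∅ := by ext b; simp [pat, hi]
          rw [this]
          exact MeasurableSet.empty
      by_cases his : i ∈ s
      · simp only [his, iff_true]
        exact h1
      · simp only [his, iff_false]
        exact h1.compl
    exact hpm (MeasurableSpace.measurableSet_top (s := {s | p s}))
  set B : Set Ω := ⋃ k ∈ Finset.range H, T.symm^[k] ⁻¹' (F ∩ {b | k ∈ Φ (pat b)}) with hBdef
  have hBm : MeasurableSet B := Finset.measurableSet_biUnion _ fun k _ =>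
    measurable_iterate_equiv T.symm k (hF.inter (hpat fun s => k ∈ Φ s))
  have hBlevel : ∀ x k, k < H → T.symm^[k] x ∈ F → (x ∈ B ↔ k ∈ Φ (pat (T.symm^[k] x))) := by
    intro x k hk hxk
    simp only [hBdef, mem_iUnion, Finset.mem_range]
    constructor
    · rintro ⟨l, hl, hlF, hlΦ⟩
      obtain rfl := h.level_unique hl hk hlF hxk
      exact hlΦ
    · exact fun hx => ⟨k, hk, hxk, hx⟩
  have hBcol : ∀ b ∈ F, ∀ k < H, (T^[k] b ∈ B ↔ k ∈ Φ (pat b)) := by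
    intro b hb k hk
    have h1 : T.symm^[k] (T^[k] b) = b := by
      rw [iterate_symm_iterate T le_rfl, Nat.sub_self]; rfl
    rw [hBlevel _ k hk (by rwa [h1]), h1]
  refine ⟨B, hBm, ?_, ?_⟩
  · intro b hb t ht
    refine le_trans (le_of_eq ?_) (hΦ2 (pat b) t ht)
    rw [Finset.sum_sub_distrib]
    congr 2
    have h1 : (Φ (pat b)).filter (· < t) = (Finset.range t).filter fun i => T^[i] b ∈ B := by
      ext i
      simp only [Finset.mem_filter, Finset.mem_range]
      constructor
      · rintro ⟨h1, h2⟩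
        exact ⟨h2, (hBcol b hb i (by omega)).2 h1⟩
      · rintro ⟨h1, h2⟩
        exact ⟨(hBcol b hb i (by omega)).1 h2, h1⟩
    rw [h1, Finset.card_filter, Nat.cast_sum]
    refine Finset.sum_congr rfl fun i _ => ?_
    by_cases hi : T^[i] b ∈ B <;> simp [hi]
  set f := centeredIndicator β A with hf
  set g : Ω → ℝ := fun x => f x - (u x - u (T x)) with hg
  have hgm : Measurable g :=
    (measurable_centeredIndicator β hA).sub (hu.sub (hu.comp T.measurable))
  have hgb : ∀ x, |g x| ≤ 1 + (M + M) := fun x =>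
    (abs_sub _ _).trans (add_le_add (abs_centeredIndicator_le hβ0 hβ1 A x)
      ((abs_sub _ _).trans (add_le_add (huM _) (huM _))))
  have hgi : Integrable (fun x => |g x|) μ := (integrable_of_measurable_of_abs_le μ hgm hgb).abs
  let D : ℕ → Set Ω := fun k => {b | k ∈ symmDiff (pat b) (Φ (pat b))}
  have hDm : ∀ k, MeasurableSet (D k) := fun k => hpat fun s => k ∈ symmDiff s (Φ s)
  have hsub : symmDiff A B ⊆ (⋃ i ∈ Finset.range H, T.symm^[i] ⁻¹' F)ᶜ ∪
      ⋃ k ∈ Finset.range H, T.symm^[k] ⁻¹' (F ∩ D k) := by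
    intro x hx
    by_cases hxL : x ∈ ⋃ i ∈ Finset.range H, T.symm^[i] ⁻¹' F
    · right
      simp only [mem_iUnion, Finset.mem_range, mem_preimage] at hxL
      obtain ⟨k, hk, hxk⟩ := hxL
      refine mem_biUnion (Finset.mem_coe.2 (Finset.mem_range.2 hk)) ⟨hxk, ?_⟩
      have h1 := hBlevel x k hk hxk
      have h2 : x ∈ A ↔ k ∈ pat (T.symm^[k] x) := by
        simp only [pat, Finset.mem_filter, Finset.mem_range, hk, true_and]
        rw [iterate_iterate_symm T le_rfl, Nat.sub_self]; rfl
      rw [mem_symmDiff, h1, h2] at hx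
      exact Finset.mem_symmDiff.2 hx
    · exact Or.inl hxL
  have hcount : ∀ b, ∑ k ∈ Finset.range H, (D k).indicator (fun _ => (1 : ℝ)) b ≤
      ∑ i ∈ Finset.range H, |g (T^[i] b)| + K * (2 * M + ρ * m + 1) := by
    intro b
    have h1 : ∑ k ∈ Finset.range H, (D k).indicator (fun _ => (1 : ℝ)) b =
        (symmDiff (pat b ∩ Finset.range H) (Φ (pat b))).card := by
      have hpr : pat b ∩ Finset.range H = pat b :=
        Finset.inter_eq_left.2 (Finset.filter_subset _ _)
      have h2 : symmDiff (pat b) (Φ (pat b)) = (Finset.range H).filter fun k => b ∈ D k := by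
        ext k
        simp only [D, mem_ofPred_eq, Finset.mem_filter]
        refine ⟨fun hk => ⟨?_, hk⟩, fun hk => hk.2⟩
        rcases Finset.mem_symmDiff.1 hk with h3 | h3
        · exact (Finset.mem_filter.1 h3.1).1
        · exact hΦ1 _ h3.1
      rw [hpr, h2, Finset.card_filter, Nat.cast_sum]
      refine Finset.sum_congr rfl fun k _ => ?_
      by_cases hk : b ∈ D k <;> simp [hk]
    rw [h1]
    refine (hΦ3 (pat b)).trans ?_
    have h2 : ∀ k ∈ Finset.range K,
        |((pat b ∩ Finset.Ico (k * m) ((k + 1) * m)).card : ℝ) -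
          ∑ i ∈ Finset.Ico (k * m) ((k + 1) * m), w i| + 1 ≤
        ∑ i ∈ Finset.Ico (k * m) ((k + 1) * m), |g (T^[i] b)| + (2 * M + ρ * m + 1) := by
      intro k hk
      have hkK : (k + 1) * m ≤ H := Nat.mul_le_mul_right _ (Finset.mem_range.1 hk)
      have hle : k * m ≤ (k + 1) * m := Nat.mul_le_mul_right _ (Nat.le_succ _)
      set I := Finset.Ico (k * m) ((k + 1) * m) with hI
      have hIc : (I.card : ℝ) = m := by
        rw [hI, Nat.card_Ico, Nat.cast_sub hle]; push_cast; ring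
      have h3 : ((pat b ∩ I).card : ℝ) = ∑ i ∈ I, A.indicator (fun _ => (1 : ℝ)) (T^[i] b) := by
        have : pat b ∩ I = I.filter fun i => T^[i] b ∈ A := by
          ext i
          simp only [pat, Finset.mem_inter, Finset.mem_filter, Finset.mem_range, hI,
            Finset.mem_Ico]
          constructor
          · rintro ⟨⟨_, h5⟩, h6⟩
            exact ⟨h6, h5⟩
          · rintro ⟨h6, h5⟩
            exact ⟨⟨by omega, h5⟩, h6⟩
        rw [this, Finset.card_filter, Nat.cast_sum]
        refine Finset.sum_congr rfl fun i _ => ?_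
        by_cases hi : T^[i] b ∈ A <;> simp [hi]
      have h4 : ((pat b ∩ I).card : ℝ) - ∑ i ∈ I, w i =
          ∑ i ∈ I, g (T^[i] b) + (u (T^[k * m] b) - u (T^[(k + 1) * m] b)) +
            ∑ i ∈ I, (β - w i) := by
        have htel : ∑ i ∈ I, (u (T^[i + 1] b) - u (T^[i] b)) =
            u (T^[(k + 1) * m] b) - u (T^[k * m] b) :=
          Finset.sum_Ico_sub (fun i => u (T^[i] b)) hle
        rw [h3, ← neg_sub (u (T^[(k + 1) * m] b)), ← htel, ← Finset.sum_neg_distrib,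
          ← Finset.sum_add_distrib, ← Finset.sum_add_distrib, ← Finset.sum_sub_distrib]
        refine Finset.sum_congr rfl fun i _ => ?_
        simp only [hg, hf, centeredIndicator, Function.iterate_succ_apply']
        ring
      have h5 : |∑ i ∈ I, (β - w i)| ≤ ρ * m := by
        refine (Finset.abs_sum_le_sum_abs _ _).trans ?_
        refine (Finset.sum_le_sum (g := fun _ => ρ) fun i _ => ?_).trans ?_
        · rw [abs_sub_comm]; exact hwρ i
        · rw [Finset.sum_const, nsmul_eq_mul, hIc, mul_comm]
      have h6 : |∑ i ∈ I, g (T^[i] b)| ≤ ∑ i ∈ I, |g (T^[i] b)| :=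
        Finset.abs_sum_le_sum_abs _ _
      have h7 : |u (T^[k * m] b) - u (T^[(k + 1) * m] b)| ≤ M + M :=
        (abs_sub _ _).trans (add_le_add (huM _) (huM _))
      rw [h4]
      have h8 := abs_add_three (∑ i ∈ I, g (T^[i] b))
        (u (T^[k * m] b) - u (T^[(k + 1) * m] b)) (∑ i ∈ I, (β - w i))
      linarith
    refine (Finset.sum_le_sum h2).trans (le_of_eq ?_)
    rw [Finset.sum_add_distrib, Finset.sum_const, Finset.card_range, nsmul_eq_mul]
    congr 1
    exact sum_range_sum_Ico_mul (fun i => |g (T^[i] b)|) K m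
  have hρ0 : 0 ≤ ρ := (abs_nonneg _).trans (hwρ 0)
  obtain ⟨x₀⟩ : Nonempty Ω := nonempty_of_isProbabilityMeasure μ
  have hM0 : 0 ≤ M := (abs_nonneg _).trans (huM x₀)
  have hm' : (0 : ℝ) < m := by exact_mod_cast hm
  have hDint : ∀ k, Integrable ((D k).indicator (fun _ => (1 : ℝ))) μ := fun k =>
    (integrable_const _).indicator (hDm k)
  have hgT : ∀ i, Integrable (fun b => |g (T^[i] b)|) μ := fun i =>
    (hT.iterate i).integrable_comp_of_integrable hgi
  have hlev : μ.real (⋃ k ∈ Finset.range H, T.symm^[k] ⁻¹' (F ∩ D k)) ≤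
      η + (2 * M + 1) / m + ρ := by
    calc μ.real (⋃ k ∈ Finset.range H, T.symm^[k] ⁻¹' (F ∩ D k))
        ≤ ∑ k ∈ Finset.range H, μ.real (T.symm^[k] ⁻¹' (F ∩ D k)) :=
          measureReal_biUnion_finset_le _ _
      _ = ∑ k ∈ Finset.range H, ∫ b in F, (D k).indicator (fun _ => (1 : ℝ)) b ∂μ := by
          refine Finset.sum_congr rfl fun k _ => ?_
          rw [measureReal_level μ hT (hF.inter (hDm k)), setIntegral_indicator (hDm k)]
          simp
      _ = ∫ b in F, ∑ k ∈ Finset.range H, (D k).indicator (fun _ => (1 : ℝ)) b ∂μ :=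
          (integral_finsetSum _ fun k _ => (hDint k).integrableOn).symm
      _ ≤ ∫ b in F, (∑ i ∈ Finset.range H, |g (T^[i] b)| + K * (2 * M + ρ * m + 1)) ∂μ := by
          refine integral_mono ?_ ?_ hcount
          · exact (integrable_finsetSum _ fun k _ => hDint k).integrableOn
          · exact ((integrable_finsetSum _ fun k _ => hgT k).add
              (integrable_const _)).integrableOn
      _ = ∑ i ∈ Finset.range H, ∫ b in F, |g (T^[i] b)| ∂μ +
            μ.real F * (K * (2 * M + ρ * m + 1)) := by
          rw [integral_add (integrable_finsetSum _ fun k _ => hgT k).integrableOn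
            (integrable_const _), integral_finsetSum _ fun k _ => (hgT k).integrableOn]
          simp
      _ ≤ η + (2 * M + 1) / m + ρ := by
          have h1 := h.sum_setIntegral_le μ hT hF hgi fun x => abs_nonneg _
          have h2 := h.mul_measureReal_le_one μ hT hF
          have h3 : μ.real F * (K * (2 * M + ρ * m + 1)) ≤ (2 * M + 1) / m + ρ := by
            rw [div_add' _ _ _ hm'.ne', le_div_iff₀ hm']
            rw [hH] at h2
            push_cast at h2
            have h4 : 0 ≤ 2 * M + ρ * m + 1 := by positivity
            nlinarith [mul_le_mul_of_nonneg_right h2 h4]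
          linarith
  calc μ.real (symmDiff A B) ≤ _ := measureReal_mono hsub
    _ ≤ _ := measureReal_union_le _ _
    _ ≤ e + (η + (2 * M + 1) / m + ρ) :=
        add_le_add (h.measureReal_compl_levels_le μ hT hF he) hlev
    _ = e + η + (2 * M + 1) / m + ρ := by ring

end Rearrangement

section Laws

variable {Ω : Type*} [MeasurableSpace Ω]

/-- If a function is close to `z j` on most of the `j`-th block of levels of a large tower, then
its law is close to the empirical measure of `z`. -/
lemma levyProkhorovDist_map_empiricalMeasure_le (μ : Measure Ω) [IsProbabilityMeasure μ]
    {T : Ω ≃ᵐ Ω} (hT : MeasurePreserving T μ μ) {q R n : ℕ} (hR : 0 < R) (hnR : n ≤ R)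
    {F : Set Ω} (hF : MeasurableSet F) (h : IsTowerBase T ((q + 1) * R) F) {e : ℝ} (he0 : 0 ≤ e)
    (he : 1 - e ≤ ((q + 1) * R : ℕ) * μ.real F) {X : Ω → ℝ} (hX : Measurable X)
    (z : Fin (q + 1) → ℝ) {δ : ℝ} (hδ : 0 ≤ δ)
    (hXz : ∀ b ∈ F, ∀ j : Fin (q + 1), ∀ r < R - n, |X (T^[j * R + r] b) - z j| ≤ δ) :
    levyProkhorovDist (μ.map X) (empiricalMeasure z) ≤ δ + e + n / R := by
  classical
  have := Measure.isProbabilityMeasure_map (μ := μ) hX.aemeasurable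
  rw [levyProkhorovDist_comm]
  have hnR0 : (0 : ℝ) ≤ n / R := by positivity
  refine levyProkhorovDist_le_of_forall_le _ _ (by positivity) fun ε B hε hB => ?_
  have hε0 : 0 ≤ ε := le_trans (by positivity) hε.le
  set J : Finset (Fin (q + 1)) := Finset.univ.filter fun j => z j ∈ B with hJ
  set s : Finset ℕ :=
    (J ×ˢ Finset.range (R - n)).image (fun p : Fin (q + 1) × ℕ => (p.1 : ℕ) * R + p.2) with hs
  have hcard : s.card = J.card * (R - n) := by
    rw [hs, Finset.card_image_of_injOn, Finset.card_product, Finset.card_range]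
    rintro ⟨j, r⟩ hj ⟨j', r'⟩ hj' hjj
    simp only [Finset.coe_product, mem_prod, Finset.mem_coe, Finset.mem_range] at hj hj' hjj
    have hr : r < R := by omega
    have hr' : r' < R := by omega
    have h1 := congrArg (· % R) hjj
    have h2 := congrArg (· / R) hjj
    simp only [Nat.mul_add_mod_self_right, Nat.mod_eq_of_lt hr, Nat.mod_eq_of_lt hr'] at h1
    simp only [Nat.mul_comm _ R, Nat.mul_add_div hR, Nat.div_eq_of_lt hr,
      Nat.div_eq_of_lt hr'] at h2
    exact Prod.ext (Fin.ext (by simpa using h2)) h1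
  have hs' : ∀ i ∈ s, i < (q + 1) * R := by
    intro i hi
    obtain ⟨⟨j, r⟩, hjr, rfl⟩ := Finset.mem_image.1 hi
    have hr : r < R - n := Finset.mem_range.1 (Finset.mem_product.1 hjr).2
    have := Nat.mul_le_mul_right R (Nat.succ_le_of_lt j.2)
    rw [Nat.succ_mul] at this
    dsimp only
    omega
  have hsub : (⋃ i ∈ s, T.symm^[i] ⁻¹' F) ⊆ X ⁻¹' Metric.thickening ε B := by
    intro x hx
    simp only [mem_iUnion, mem_preimage] at hx
    obtain ⟨i, hi, hxi⟩ := hx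
    obtain ⟨⟨j, r⟩, hjr, rfl⟩ := Finset.mem_image.1 hi
    have hr : r < R - n := Finset.mem_range.1 (Finset.mem_product.1 hjr).2
    have hj : z j ∈ B := (Finset.mem_filter.1 (Finset.mem_product.1 hjr).1).2
    have h1 := hXz _ hxi j r hr
    rw [iterate_iterate_symm T le_rfl, Nat.sub_self] at h1
    refine Metric.mem_thickening_iff.2 ⟨z j, hj, ?_⟩
    rw [Real.dist_eq]
    exact h1.trans_lt (by linarith)
  have hreal : (empiricalMeasure z).real B ≤
      (μ.map X).real (Metric.thickening ε B) + ε := by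
    have h1 : (empiricalMeasure z).real B = J.card / (q + 1 : ℕ) := by
      rw [empiricalMeasure_real_apply z hB, hJ, Finset.card_filter, Nat.cast_sum]
      congr 1
      refine Finset.sum_congr rfl fun j _ => ?_
      by_cases hj : z j ∈ B <;> simp [hj]
    have h2 : s.card * μ.real F ≤ (μ.map X).real (Metric.thickening ε B) := by
      rw [map_measureReal_apply hX Metric.isOpen_thickening.measurableSet,
        ← h.measureReal_levels μ hT hF hs']
      exact measureReal_mono hsub
    rw [h1]
    rw [hcard, Nat.cast_mul, Nat.cast_sub hnR] at h2
    have hq0 : (0 : ℝ) < (q + 1 : ℕ) := by positivity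
    have hR0 : (0 : ℝ) < R := by exact_mod_cast hR
    set θ : ℝ := J.card / (q + 1 : ℕ) with hθ
    have hθ0 : 0 ≤ θ := by positivity
    have hθ1 : θ ≤ 1 := by
      rw [hθ, div_le_one hq0]
      exact_mod_cast (Finset.card_le_univ J).trans (by simp)
    have hJθ : (J.card : ℝ) = θ * (q + 1 : ℕ) := by rw [hθ, div_mul_cancel₀ _ hq0.ne']
    set v : ℝ := n / R with hv
    have hv1 : v ≤ 1 := by
      rw [hv, div_le_one hR0]
      exact_mod_cast hnR
    have hnv : (n : ℝ) = v * R := by rw [hv, div_mul_cancel₀ _ hR0.ne']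
    rw [hJθ, hnv] at h2
    rw [Nat.cast_mul] at he
    have h3 : θ * (1 - v) * (1 - e) ≤ θ * (1 - v) * ((q + 1 : ℕ) * R * μ.real F) :=
      mul_le_mul_of_nonneg_left he (mul_nonneg hθ0 (by linarith))
    nlinarith [mul_nonneg hθ0 (mul_nonneg hnR0 he0), mul_nonneg (sub_nonneg.2 hθ1) hnR0,
      mul_nonneg (sub_nonneg.2 hθ1) he0]
  rw [← ENNReal.ofReal_toReal (measure_ne_top (empiricalMeasure z) B),
    ← ENNReal.ofReal_toReal (measure_ne_top (μ.map X) (Metric.thickening ε B)),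
    ← ENNReal.ofReal_add ENNReal.toReal_nonneg hε0]
  exact ENNReal.ofReal_le_ofReal hreal

lemma sum_range_mul_comp_div (g : ℕ → ℝ) (R Q : ℕ) :
    ∑ i ∈ Finset.range (Q * R), g (i / R) = R * ∑ j ∈ Finset.range Q, g j := by
  rw [← sum_range_sum_Ico_mul, Finset.mul_sum]
  refine Finset.sum_congr rfl fun j _ => ?_
  have h1 : ∀ i ∈ Finset.Ico (j * R) ((j + 1) * R), g (i / R) = g j := by
    intro i hi
    rw [Finset.mem_Ico] at hi
    rw [Nat.div_eq_of_lt_le hi.1 hi.2]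
  rw [Finset.sum_congr rfl h1, Finset.sum_const, Nat.card_Ico, nsmul_eq_mul, Nat.succ_mul,
    Nat.add_sub_cancel_left]

end Laws

section Construction

/-- The normalized centered sums of the indicator function of `B`. -/
noncomputable def normalizedSum {Ω : Type*} (T : Ω → Ω) (β c : ℝ) (n : ℕ) (B : Set Ω) (x : Ω) : ℝ :=
  c⁻¹ * ∑ i ∈ Finset.range n, centeredIndicator β B (T^[i] x)

lemma abs_normalizedSum_sub_le {Ω : Type*} (T : Ω → Ω) {β c C v : ℝ} (hc : 0 < c) {n s : ℕ} (hn : 0 < n)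
    {B : Set Ω} {b : Ω} {w : ℕ → ℝ} (hw : ∀ i < n, w (s + i) = β + c / n * v)
    (hC : ∀ t ≤ s + n,
      |∑ i ∈ Finset.range t, (B.indicator (fun _ => (1 : ℝ)) (T^[i] b) - w i)| ≤ C) :
    |normalizedSum T β c n B (T^[s] b) - v| ≤ 2 * C / c := by
  have hn' : (n : ℝ) ≠ 0 := by exact_mod_cast hn.ne'
  have h1 : ∑ i ∈ Finset.range n, centeredIndicator β B (T^[i] (T^[s] b)) =
      ∑ i ∈ Finset.range n, (B.indicator (fun _ => (1 : ℝ)) (T^[s + i] b) - w (s + i)) +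
        c * v := by
    have h2 : c * v = ∑ i ∈ Finset.range n, c / n * v := by
      rw [Finset.sum_const, Finset.card_range, nsmul_eq_mul]
      field_simp
    rw [h2, ← Finset.sum_add_distrib]
    refine Finset.sum_congr rfl fun i hi => ?_
    rw [hw i (Finset.mem_range.1 hi), centeredIndicator, ← Function.iterate_add_apply,
      Nat.add_comm i s]
    ring
  have h3 := Finset.sum_range_add
    (fun i => B.indicator (fun _ => (1 : ℝ)) (T^[i] b) - w i) s n
  have h4 := hC (s + n) le_rfl
  have h5 := hC s (Nat.le_add_right _ _)
  rw [normalizedSum, h1, mul_add, inv_mul_cancel_left₀ hc.ne', add_sub_cancel_right, abs_mul,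
    abs_inv, abs_of_pos hc, inv_mul_eq_div]
  gcongr
  rw [abs_le] at h4 h5 ⊢
  constructor <;> linarith

variable {Ω : Type*} [MeasurableSpace Ω]

lemma NearCoboundary.mono {μ : Measure Ω} {T : Ω ≃ᵐ Ω} {β : ℝ} {A : Set Ω} {η η' : ℝ}
    (h : NearCoboundary μ T β A η) (hη : η ≤ η') : NearCoboundary μ T β A η' := by
  obtain ⟨u, hu, hK, hint⟩ := h
  exact ⟨u, hu, hK, hint.trans hη⟩

lemma measurable_normalizedSum {T : Ω → Ω} (hT : Measurable T) (β c : ℝ) (n : ℕ) {B : Set Ω}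
    (hB : MeasurableSet B) : Measurable (normalizedSum T β c n B) :=
  (Finset.measurable_sum _ fun i _ =>
    (measurable_centeredIndicator β hB).comp (hT.iterate i)).const_mul _

/-- A set whose centered indicator function is nearly a coboundary can be slightly modified so
that, along some large time, its normalized sums have approximately a given law, and its centered
indicator function is as near to a coboundary as desired. -/
lemma exists_modification [StandardBorelSpace Ω] (μ : Measure Ω) [IsProbabilityMeasure μ]
    {T : Ω ≃ᵐ Ω} (hT : MeasurePreserving T μ μ) (haper : ∀ᵐ x ∂μ, ∀ i ≥ 1, T^[i] x ≠ x)
    {a : ℕ → ℝ} (ha_pos : ∀ n, 0 < a n) (ha_top : Tendsto a atTop atTop)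
    (ha_small : Tendsto (fun n => a n / n) atTop (𝓝 0))
    {β : ℝ} (hβ0 : 0 < β) (hβ1 : β < 1) {A : Set Ω} (hA : MeasurableSet A) {η : ℝ} (hη : 0 < η)
    (hAη : NearCoboundary μ T β A η) (ν : Measure ℝ) [IsProbabilityMeasure ν]
    (hint : Integrable (fun x : ℝ => x) ν) (hmean : ∫ x, x ∂ν = 0) {δ : ℝ} (hδ : 0 < δ) (N : ℕ) :
    ∃ n ≥ N, ∀ η' > 0, ∃ B : Set Ω, MeasurableSet B ∧ μ.real (symmDiff A B) ≤ 2 * η ∧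
      levyProkhorovDist (μ.map (normalizedSum T β (a n) n B)) ν ≤ δ ∧
      NearCoboundary μ T β B η' := by
  obtain ⟨u, hu, ⟨M, huM⟩, huη⟩ := hAη
  obtain ⟨x₀⟩ : Nonempty Ω := nonempty_of_isProbabilityMeasure μ
  have hM0 : 0 ≤ M := (abs_nonneg _).trans (huM x₀)
  obtain ⟨m, hm⟩ := exists_nat_gt ((2 * M + 1) / (η / 4))
  have hm0 : (0 : ℝ) < m := lt_of_le_of_lt (by positivity) hm
  have hmη : (2 * M + 1) / m ≤ η / 4 := by
    rw [div_lt_iff₀ (by positivity)] at hm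
    rw [div_le_iff₀ hm0]
    linarith
  obtain ⟨q, z, hz0, hzν⟩ := exists_empiricalMeasure_close ν hint hmean (half_pos hδ)
  set Z : ℝ := ∑ j, |z j| with hZ
  have hzZ : ∀ j, |z j| ≤ Z := fun j =>
    Finset.single_le_sum (f := fun j => |z j|) (fun j _ => abs_nonneg _) (Finset.mem_univ j)
  set c : ℝ := min (min β (1 - β)) (η / 4) with hc
  have hc0 : 0 < c := lt_min (lt_min hβ0 (by linarith)) (by positivity)
  have hlim : Tendsto (fun n => a n / n * Z) atTop (𝓝 0) := by
    simpa using ha_small.mul_const Z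
  obtain ⟨n, hnZ, hna, hnN, hn0⟩ : ∃ n : ℕ, a n / n * Z < c ∧ 2 * (m + 1) / (δ / 8) ≤ a n ∧
      N ≤ n ∧ 0 < n :=
    ((hlim.eventually_lt_const hc0).and ((ha_top.eventually_ge_atTop _).and
      ((eventually_ge_atTop N).and (eventually_gt_atTop 0)))).exists
  have han := ha_pos n
  have hna' : 2 * (m + 1) / a n ≤ δ / 8 := by
    rw [div_le_iff₀ (by positivity)] at hna
    rw [div_le_iff₀ han]
    linarith
  refine ⟨n, hnN, fun η' hη' => ?_⟩
  set e : ℝ := min (min (η / 4) (δ / 8)) (η' / 2) with he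
  have he0 : 0 < e := by positivity
  have he1 : e ≤ η / 4 := (min_le_left _ _).trans (min_le_left _ _)
  have he2 : e ≤ δ / 8 := (min_le_left _ _).trans (min_le_right _ _)
  have he3 : e ≤ η' / 2 := min_le_right _ _
  obtain ⟨R', hR'⟩ := exists_nat_gt (n + n / (δ / 8) + (m + 1) / (η' / 2))
  have hRm : 1 ≤ m := by exact_mod_cast hm0
  set R : ℕ := R' * m with hR
  have hRR' : (R' : ℝ) ≤ R := by exact_mod_cast Nat.le_mul_of_pos_right R' hRm
  have hp1 : 0 ≤ n / (δ / 8) := by positivity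
  have hp2 : 0 ≤ (m + 1) / (η' / 2) := by positivity
  have hn0' : (0 : ℝ) < n := by exact_mod_cast hn0
  have hR0' : (0 : ℝ) < R := by linarith
  have hR0 : 0 < R := by exact_mod_cast hR0'
  have hnR : n ≤ R := by
    have : (n : ℝ) ≤ R := by linarith
    exact_mod_cast this
  have hnRδ : n / R ≤ δ / 8 := by
    have : n / (δ / 8) ≤ (R : ℝ) := by linarith
    rw [div_le_iff₀ (by positivity)] at this
    rw [div_le_iff₀ hR0']
    linarith
  set K : ℕ := (q + 1) * R' with hK
  have hKm : K * m = (q + 1) * R := by rw [hK, hR, Nat.mul_assoc]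
  have hRK : (R : ℝ) ≤ (K * m : ℕ) := by
    rw [hKm]
    exact_mod_cast Nat.le_mul_of_pos_left R (Nat.succ_pos q)
  have hH0 : 0 < K * m := by rw [hKm]; positivity
  have hmH : (m + 1) / ((K * m : ℕ) : ℝ) ≤ η' / 2 := by
    have : (m + 1) / (η' / 2) ≤ ((K * m : ℕ) : ℝ) := by linarith
    rw [div_le_iff₀ (by positivity)] at this
    rw [div_le_iff₀ (by exact_mod_cast hH0)]
    linarith
  obtain ⟨F, hF, hFt, hFe⟩ := exists_rokhlin_tower μ hT haper hH0 he0
  let y : ℕ → ℝ := fun j => if h : j < q + 1 then z ⟨j, h⟩ else 0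
  have hy : ∀ j : Fin (q + 1), y j = z j := fun j => dif_pos j.2
  have hyZ : ∀ j, |y j| ≤ Z := by
    intro j
    by_cases hj : j < q + 1
    · simpa only [y, dif_pos hj] using hzZ ⟨j, hj⟩
    · simp only [y, dif_neg hj, abs_zero]
      exact (abs_nonneg _).trans (hzZ 0)
  have hy0 : ∑ j ∈ Finset.range (q + 1), y j = 0 := by
    rw [Finset.sum_range, ← hz0]
    exact Finset.sum_congr rfl fun j _ => hy j
  let w : ℕ → ℝ := fun i => β + a n / n * y (i / R)
  have hwc : ∀ i, |w i - β| ≤ c := by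
    intro i
    simp only [w]
    rw [add_sub_cancel_left, abs_mul, abs_of_pos (by positivity : 0 < a n / n)]
    exact (mul_le_mul_of_nonneg_left (hyZ _) (by positivity)).trans hnZ.le
  have hw0 : ∀ i, 0 ≤ w i := fun i => by
    have h1 := (abs_le.1 (hwc i)).1
    have h2 : c ≤ β := (min_le_left _ _).trans (min_le_left _ _)
    linarith
  have hw1 : ∀ i, w i ≤ 1 := fun i => by
    have h1 := (abs_le.1 (hwc i)).2
    have h2 : c ≤ 1 - β := (min_le_left _ _).trans (min_le_right _ _)
    linarith
  obtain ⟨B, hB, hcol, hAB⟩ := exists_rearrangement μ hT hRm hF hFt hFe hβ0.le hβ1.le hA hu huM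
    huη w hw0 hw1 hwc
  have hm1 : (0 : ℝ) ≤ m + 1 := by positivity
  refine ⟨B, hB, ?_, ?_, ?_⟩
  · have : c ≤ η / 4 := min_le_right _ _
    linarith
  · have := Measure.isProbabilityMeasure_map (μ := μ)
      (measurable_normalizedSum T.measurable β (a n) n hB).aemeasurable
    have hlaw : levyProkhorovDist (μ.map (normalizedSum T β (a n) n B)) (empiricalMeasure z) ≤
        δ / 8 + e + n / R := by
      rw [hKm] at hFt hFe
      refine levyProkhorovDist_map_empiricalMeasure_le μ hT hR0 hnR hF hFt he0.le hFe
        (measurable_normalizedSum T.measurable β (a n) n hB) z (by positivity) ?_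
      intro b hb j r hr
      refine (abs_normalizedSum_sub_le T han hn0 (w := w) (C := m + 1) ?_ ?_).trans hna'
      · intro i hi
        simp only [w]
        rw [Nat.div_eq_of_lt_le (k := j) (by omega) (by rw [Nat.succ_mul]; omega), hy]
      · intro t ht
        refine hcol b hb t (ht.trans ?_)
        have := Nat.mul_le_mul_right R (Nat.succ_le_of_lt j.2)
        rw [Nat.succ_mul] at this
        rw [hKm]
        omega
    refine (levyProkhorovDist_triangle _ (empiricalMeasure z) _).trans ?_
    linarith
  · refine (nearCoboundary_of_tower μ hT hH0 hF hFt hFe hβ0.le hβ1.le hB hm1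
      fun b hb => ?_).mono (η' := η') (by linarith)
    refine le_trans (le_of_eq ?_) (hcol b hb _ le_rfl)
    have hwsum : ∑ i ∈ Finset.range (K * m), w i = ∑ i ∈ Finset.range (K * m), β := by
      simp only [w]
      rw [Finset.sum_add_distrib, ← Finset.mul_sum, hKm, sum_range_mul_comp_div y R, hy0]
      simp
    simp only [centeredIndicator]
    rw [Finset.sum_sub_distrib, Finset.sum_sub_distrib, hwsum]

end Construction

section Limit

variable {Ω : Type*} [MeasurableSpace Ω]

/-- A sequence of sets whose successive differences decay geometrically in measure converges. -/
lemma exists_limit_set (μ : Measure Ω) [IsProbabilityMeasure μ] {A : ℕ → Set Ω}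
    (hA : ∀ k, MeasurableSet (A k)) {d : ℕ → ℝ} (hd0 : ∀ k, 0 ≤ d k)
    (hd : ∀ k, d (k + 1) ≤ d k / 2) (hAd : ∀ k, μ.real (symmDiff (A k) (A (k + 1))) ≤ d k) :
    ∃ A' : Set Ω, MeasurableSet A' ∧ ∀ k, μ.real (symmDiff (A k) A') ≤ 2 * d k := by
  refine ⟨⋃ K, ⋂ k ≥ K, A k, MeasurableSet.iUnion fun K => MeasurableSet.iInter fun k =>
    MeasurableSet.iInter fun _ => hA k, fun k => ?_⟩
  have hsub : symmDiff (A k) (⋃ K, ⋂ k ≥ K, A k) ⊆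
      ⋃ i, symmDiff (A (k + i)) (A (k + i + 1)) := by
    intro x hx
    by_contra hcon
    simp only [mem_iUnion, mem_symmDiff, not_exists] at hcon
    have hstep : ∀ i, x ∈ A (k + i) ↔ x ∈ A k := by
      intro i
      induction i with
      | zero => rfl
      | succ i ih =>
        rw [← ih]
        have := hcon i
        rw [← Nat.add_assoc]
        tauto
    have hlim : x ∈ (⋃ K, ⋂ k ≥ K, A k) ↔ x ∈ A k := by
      simp only [mem_iUnion, mem_iInter]
      constructor
      · rintro ⟨K, hK⟩
        exact (hstep K).1 (hK _ (Nat.le_add_left _ _))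
      · intro hxk
        refine ⟨k, fun l hl => ?_⟩
        obtain ⟨i, rfl⟩ := Nat.exists_eq_add_of_le hl
        exact (hstep i).2 hxk
    rw [mem_symmDiff, hlim] at hx
    tauto
  have hgeo : ∀ i, d (k + i) ≤ d k * (1 / 2) ^ i := by
    intro i
    induction i with
    | zero => simp
    | succ i ih =>
      rw [← Nat.add_assoc, pow_succ]
      linarith [hd (k + i)]
  refine ENNReal.toReal_le_of_le_ofReal (by linarith [hd0 k]) ?_
  calc μ (symmDiff (A k) (⋃ K, ⋂ k ≥ K, A k))
      ≤ ∑' i, μ (symmDiff (A (k + i)) (A (k + i + 1))) :=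
        (measure_mono hsub).trans (measure_iUnion_le _)
    _ ≤ ∑' i : ℕ, ENNReal.ofReal (d k * (1 / 2) ^ i) := by
        refine ENNReal.tsum_le_tsum fun i => ?_
        rw [← ENNReal.ofReal_toReal (measure_ne_top μ (symmDiff (A (k + i)) (A (k + i + 1))))]
        exact ENNReal.ofReal_le_ofReal ((hAd (k + i)).trans (hgeo i))
    _ = ENNReal.ofReal (2 * d k) := by
        rw [← ENNReal.ofReal_tsum_of_nonneg (fun i => mul_nonneg (hd0 k) (by positivity))
          (summable_geometric_two.mul_left _), tsum_mul_left, tsum_geometric_two, mul_comm]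

lemma NearCoboundary.abs_measureReal_sub_le {μ : Measure Ω} [IsProbabilityMeasure μ]
    {T : Ω ≃ᵐ Ω} (hT : MeasurePreserving T μ μ) {β : ℝ} {A : Set Ω} (hA : MeasurableSet A)
    {η : ℝ} (h : NearCoboundary μ T β A η) : |μ.real A - β| ≤ η := by
  obtain ⟨u, hu, ⟨K, hK⟩, hint⟩ := h
  have hui : Integrable u μ := integrable_of_measurable_of_abs_le μ hu hK
  have hAi : Integrable (A.indicator fun _ => (1 : ℝ)) μ := (integrable_const _).indicator hA
  have huT : ∫ x, u (T x) ∂μ = ∫ x, u x ∂μ := hT.integral_comp' (f := T) u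
  have huTi : Integrable (fun x => u (T x)) μ := hT.integrable_comp_of_integrable hui
  have h1 : ∫ x, (centeredIndicator β A x - (u x - u (T x))) ∂μ = μ.real A - β := by
    have h2 : Integrable (fun x => A.indicator (fun _ => (1 : ℝ)) x - β) μ :=
      hAi.sub (integrable_const _)
    have h3 : Integrable (fun x => u x - u (T x)) μ := hui.sub huTi
    simp only [centeredIndicator]
    rw [integral_sub h2 h3, integral_sub hui huTi, huT,
      integral_sub hAi (integrable_const _), integral_indicator_const _ hA]
    simp
  rw [← h1]
  exact abs_integral_le_integral_abs.trans hint

lemma integral_abs_normalizedSum_sub_le (μ : Measure Ω) [IsProbabilityMeasure μ] {T : Ω → Ω}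
    (hT : MeasurePreserving T μ μ) (β : ℝ) {c : ℝ} (hc : 0 < c) (n : ℕ) {A B : Set Ω}
    (hA : MeasurableSet A) (hB : MeasurableSet B) :
    Integrable (fun x => normalizedSum T β c n A x - normalizedSum T β c n B x) μ ∧
      ∫ x, |normalizedSum T β c n A x - normalizedSum T β c n B x| ∂μ ≤
        n * μ.real (symmDiff B A) / c := by
  have hS : MeasurableSet (symmDiff B A) := hB.symmDiff hA
  set φ : Ω → ℝ := (symmDiff B A).indicator fun _ => (1 : ℝ) with hφ
  have hφi : Integrable φ μ := (integrable_const _).indicator hS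
  have hφT : ∀ i, Integrable (fun x => φ (T^[i] x)) μ := fun i =>
    (hT.iterate i).integrable_comp_of_integrable hφi
  have hle : ∀ x, |normalizedSum T β c n A x - normalizedSum T β c n B x| ≤
      c⁻¹ * ∑ i ∈ Finset.range n, φ (T^[i] x) := by
    intro x
    rw [normalizedSum, normalizedSum, ← mul_sub, abs_mul, abs_of_pos (inv_pos.2 hc),
      ← Finset.sum_sub_distrib]
    refine mul_le_mul_of_nonneg_left ?_ (inv_pos.2 hc).le
    refine (Finset.abs_sum_le_sum_abs _ _).trans (Finset.sum_le_sum fun i _ => ?_)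
    rw [centeredIndicator, centeredIndicator, sub_sub_sub_cancel_right]
    by_cases h1 : T^[i] x ∈ A <;> by_cases h2 : T^[i] x ∈ B <;>
      simp [hφ, mem_symmDiff, h1, h2, indicator]
  have hdom : Integrable (fun x => c⁻¹ * ∑ i ∈ Finset.range n, φ (T^[i] x)) μ :=
    (integrable_finsetSum _ fun i _ => hφT i).const_mul _
  refine ⟨hdom.mono' ((measurable_normalizedSum hT.measurable β c n hA).sub
    (measurable_normalizedSum hT.measurable β c n hB)).aestronglyMeasurable (ae_of_all _ hle), ?_⟩
  refine (integral_mono_of_nonneg (ae_of_all _ fun _ => abs_nonneg _) hdom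
    (ae_of_all _ hle)).trans (le_of_eq ?_)
  have hint : ∀ i, ∫ x, φ (T^[i] x) ∂μ = μ.real (symmDiff B A) := by
    intro i
    have h1 : (fun x => φ (T^[i] x)) = (T^[i] ⁻¹' symmDiff B A).indicator fun _ => (1 : ℝ) := by
      rfl
    rw [h1, integral_indicator_const _ ((hT.iterate i).measurable hS),
      (hT.iterate i).measureReal_preimage hS.nullMeasurableSet, smul_eq_mul, mul_one]
  rw [integral_const_mul, integral_finsetSum _ fun i _ => hφT i]
  simp_rw [hint]
  rw [Finset.sum_const, Finset.card_range, nsmul_eq_mul, inv_mul_eq_div]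

/-- There is a set of any given measure `β ∈ (0, 1)` whose normalized sums have laws asymptotic
to the given ones. -/
lemma exists_set_forall_levyProkhorovDist_le [StandardBorelSpace Ω] (μ : Measure Ω)
    [IsProbabilityMeasure μ] {T : Ω ≃ᵐ Ω} (hT : MeasurePreserving T μ μ)
    (haper : ∀ᵐ x ∂μ, ∀ i ≥ 1, T^[i] x ≠ x)
    {a : ℕ → ℝ} (ha_pos : ∀ n, 0 < a n) (ha_top : Tendsto a atTop atTop)
    (ha_small : Tendsto (fun n => a n / n) atTop (𝓝 0))
    {β : ℝ} (hβ0 : 0 < β) (hβ1 : β < 1) (ν : ℕ → Measure ℝ) [∀ k, IsProbabilityMeasure (ν k)]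
    (hint : ∀ k, Integrable (fun x : ℝ => x) (ν k)) (hmean : ∀ k, ∫ x, x ∂(ν k) = 0) :
    ∃ A : Set Ω, MeasurableSet A ∧ μ.real A = β ∧ ∃ n : ℕ → ℕ, StrictMono n ∧ (∀ k, 1 ≤ n k) ∧
      ∀ k : ℕ, levyProkhorovDist (μ.map (normalizedSum T β (a (n k)) (n k) A)) (ν k) ≤
        2 / ((k : ℝ) + 1) := by
  let S : Type _ := {s : Set Ω × ℝ × ℕ //
    MeasurableSet s.1 ∧ 0 < s.2.1 ∧ NearCoboundary μ T β s.1 s.2.1}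
  have hstep : ∀ (k : ℕ) (s : S), ∃ s' : S, s.1.2.2 < s'.1.2.2 ∧ s'.1.2.1 ≤ s.1.2.1 / 2 ∧
      s'.1.2.2 * (4 * s'.1.2.1) / a s'.1.2.2 ≤ (1 / ((k : ℝ) + 1)) ^ 2 ∧
      μ.real (symmDiff s.1.1 s'.1.1) ≤ 2 * s.1.2.1 ∧
      levyProkhorovDist (μ.map (normalizedSum T β (a s'.1.2.2) s'.1.2.2 s'.1.1)) (ν k) ≤
        1 / ((k : ℝ) + 1) := by
    rintro k ⟨⟨A, η, N⟩, hA, hη, hAη⟩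
    obtain ⟨n, hnN, hn⟩ := exists_modification μ hT haper ha_pos ha_top ha_small hβ0 hβ1 hA hη hAη
      (ν k) (hint k) (hmean k) (δ := 1 / ((k : ℝ) + 1)) (by positivity) (N + 1)
    have han := ha_pos n
    have hn0 : (0 : ℝ) < n := by
      have : 0 < n := by omega
      exact_mod_cast this
    set t : ℝ := (1 / ((k : ℝ) + 1)) ^ 2 with ht
    have ht0 : 0 < t := by positivity
    dsimp only at hη
    obtain ⟨B, hB, hAB, hBν, hBη⟩ := hn (min (η / 2) (t * a n / (4 * n))) (by positivity)
    refine ⟨⟨⟨B, _, n⟩, hB, by positivity, hBη⟩, hnN, min_le_left _ _, ?_, hAB, hBν⟩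
    dsimp only
    rw [div_le_iff₀ han]
    have h1 : min (η / 2) (t * a n / (4 * n)) ≤ t * a n / (4 * n) := min_le_right _ _
    rw [le_div_iff₀ (by positivity)] at h1
    linarith
  choose next hn1 hn2 hn3 hn4 hn5 using hstep
  have h0 : NearCoboundary μ T β ∅ 1 := by
    refine ⟨fun _ => 0, measurable_const, ⟨0, fun _ => by simp⟩, ?_⟩
    simp [centeredIndicator, abs_of_pos hβ0, hβ1.le]
  let s : ℕ → S := fun k => Nat.rec ⟨⟨∅, 1, 0⟩, MeasurableSet.empty, one_pos, h0⟩ next k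
  have hs : ∀ k, s (k + 1) = next k (s k) := fun k => rfl
  have hη0 : ∀ k, 0 < (s k).1.2.1 := fun k => (s k).2.2.1
  have hηstep : ∀ k, (s (k + 1)).1.2.1 ≤ (s k).1.2.1 / 2 := fun k => hn2 k (s k)
  have hNstep : ∀ k, (s k).1.2.2 < (s (k + 1)).1.2.2 := fun k => hn1 k (s k)
  obtain ⟨A, hA, hAs⟩ := exists_limit_set μ (A := fun k => (s k).1.1) (fun k => (s k).2.1)
    (d := fun k => 2 * (s k).1.2.1) (fun k => by linarith [hη0 k])
    (fun k => by linarith [hηstep k]) (fun k => hn4 k (s k))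
  have hηlim : Tendsto (fun k => (s k).1.2.1) atTop (𝓝 0) := by
    have hle : ∀ k, (s k).1.2.1 ≤ (1 / 2) ^ k := by
      intro k
      induction k with
      | zero => simp [s]
      | succ k ih =>
        rw [pow_succ]
        linarith [hηstep k]
    exact squeeze_zero (fun k => (hη0 k).le) hle
      (tendsto_pow_atTop_nhds_zero_of_lt_one (by norm_num) (by norm_num))
  have hAβ : μ.real A = β := by
    have hle : ∀ k, |μ.real A - β| ≤ 5 * (s k).1.2.1 := by
      intro k
      have h1 := (s k).2.2.2.abs_measureReal_sub_le hT (s k).2.1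
      have h2 := abs_measureReal_sub_le_measureReal_symmDiff (μ := μ)
        (s k).2.1.nullMeasurableSet hA.nullMeasurableSet
      have h3 := hAs k
      rw [abs_le] at h1 h2 ⊢
      constructor <;> linarith
    have h1 : Tendsto (fun k => 5 * (s k).1.2.1) atTop (𝓝 0) := by
      simpa using hηlim.const_mul 5
    have h2 : |μ.real A - β| ≤ 0 := ge_of_tendsto' h1 hle
    exact sub_eq_zero.1 (abs_nonpos_iff.1 h2)
  refine ⟨A, hA, hAβ, fun k => (s (k + 1)).1.2.2, strictMono_nat_of_lt_succ fun k =>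
    hNstep (k + 1), fun k => Nat.one_le_of_lt (hNstep k), fun k => ?_⟩
  set n := (s (k + 1)).1.2.2 with hn
  have hmA := measurable_normalizedSum T.measurable β (a n) n hA
  have hmB := measurable_normalizedSum T.measurable β (a n) n (s (k + 1)).2.1
  have := Measure.isProbabilityMeasure_map (μ := μ) hmA.aemeasurable
  have := Measure.isProbabilityMeasure_map (μ := μ) hmB.aemeasurable
  obtain ⟨hi1, hi2⟩ := integral_abs_normalizedSum_sub_le μ hT β (ha_pos n) n hA (s (k + 1)).2.1
  have hLP : levyProkhorovDist (μ.map (normalizedSum T β (a n) n A))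
      (μ.map (normalizedSum T β (a n) n (s (k + 1)).1.1)) ≤ 1 / ((k : ℝ) + 1) := by
    refine levyProkhorovDist_map_le_of_integral_le μ hmA hmB hi1 (by positivity) (hi2.trans ?_)
    refine le_trans ?_ (hn3 k (s k))
    have h1 := hAs (k + 1)
    have h2 := ha_pos n
    rw [← hs, ← hn]
    gcongr
    linarith
  refine (levyProkhorovDist_triangle _ (μ.map (normalizedSum T β (a n) n (s (k + 1)).1.1))
    _).trans ?_
  have h1 := hn5 k (s k)
  rw [← hs, ← hn] at h1
  calc _ ≤ 1 / ((k : ℝ) + 1) + 1 / ((k : ℝ) + 1) := add_le_add hLP h1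
    _ = 2 / ((k : ℝ) + 1) := by ring

end Limit

/-- In every aperiodic dynamical system on a standard Borel probability
space, for every `ε > 0` and every sequence `ν k` (for `k ≥ 1`) of zero-mean Borel
probability measures on `ℝ`, there are a measurable set `A` with `μ A < ε` and a
strictly increasing sequence of positive integers `n k` such that the Lévy–Prokhorov
distance between the law of `(a (n k))⁻¹ • S_{n k}(1_A − μ A)` and `ν k` tends to `0`. -/
theorem indicator_limit_along_sequence
    {Ω : Type*} [MeasurableSpace Ω] [StandardBorelSpace Ω]
    (μ : Measure Ω) [IsProbabilityMeasure μ]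
    (T : Ω → Ω) (hT : MeasurePreserving T μ μ) (hTbij : Function.Bijective T)
    (haper : μ {x | ∃ n ≥ 1, T^[n] x = x} = 0)
    (a : ℕ → ℝ) (ha_pos : ∀ n, 0 < a n) (ha_mono : Monotone a)
    (ha_top : Tendsto a atTop atTop)
    (ha_small : Tendsto (fun n => a n / n) atTop (𝓝 0))
    (ε : ℝ) (hε : 0 < ε)
    (ν : ℕ → Measure ℝ) (hν_prob : ∀ k ≥ 1, IsProbabilityMeasure (ν k))
    (hν_int : ∀ k ≥ 1, Integrable (fun x : ℝ => x) (ν k))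
    (hν_mean : ∀ k ≥ 1, ∫ x, x ∂(ν k) = 0) :
    ∃ A : Set Ω, MeasurableSet A ∧ μ A < ENNReal.ofReal ε ∧
      ∃ n : ℕ → ℕ, StrictMono n ∧ (∀ k, 1 ≤ n k) ∧
        Tendsto
          (fun k => levyProkhorovDist
            (μ.map (fun x => (a (n k))⁻¹ *
              ∑ i ∈ Finset.range (n k),
                (A.indicator (fun _ => (1 : ℝ)) (T^[i] x) - (μ A).toReal)))
            (ν k))
          atTop (𝓝 0) := by
  have hTm : MeasurableEmbedding T := hT.measurable.measurableEmbedding hTbij.1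
  let T' : Ω ≃ᵐ Ω :=
    { Equiv.ofBijective T hTbij with
      measurable_toFun := hT.measurable
      measurable_invFun := by
        intro s hs
        rw [← Equiv.image_eq_preimage_symm]
        exact hTm.measurableSet_image.2 hs }
  have hT' : MeasurePreserving T' μ μ := hT
  have haper' : ∀ᵐ x ∂μ, ∀ i ≥ 1, T'^[i] x ≠ x := by
    rw [ae_iff]
    simp only [not_forall, not_not, exists_prop]
    exact haper
  have hν_prob' : ∀ k, IsProbabilityMeasure (ν (max k 1)) := fun k =>
    hν_prob _ (le_max_right _ _)
  have hβ0 : 0 < min ε 1 / 2 := by positivity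
  have hβ1 : min ε 1 / 2 < 1 := by linarith [min_le_right ε 1]
  obtain ⟨A, hA, hAβ, n, hn, hn1, hlaw⟩ := exists_set_forall_levyProkhorovDist_le μ hT' haper'
    ha_pos ha_top ha_small hβ0 hβ1 (fun k => ν (max k 1))
    (fun k => hν_int _ (le_max_right _ _)) (fun k => hν_mean _ (le_max_right _ _))
  refine ⟨A, hA, ?_, n, hn, hn1, ?_⟩
  · rw [← ENNReal.ofReal_toReal (measure_ne_top μ A), ENNReal.ofReal_lt_ofReal_iff hε]
    have h1 : (μ A).toReal = min ε 1 / 2 := hAβ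
    linarith [min_le_left ε 1]
  · have h1 : (μ A).toReal = min ε 1 / 2 := hAβ
    rw [h1]
    have hlim : Tendsto (fun k : ℕ => 2 / ((k : ℝ) + 1)) atTop (𝓝 0) :=
      tendsto_const_nhds.div_atTop
        (tendsto_atTop_add_const_right _ _ tendsto_natCast_atTop_atTop)
    refine squeeze_zero' (Eventually.of_forall fun k => ENNReal.toReal_nonneg) ?_ hlim
    filter_upwards [eventually_ge_atTop 1] with k hk
    have h2 := hlaw k
    rw [max_eq_left hk] at h2
    exact h2
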